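/- arXiv:2001.06753 — 2 statements merged into one kernel-verified Lean document; each statement's English description precedes it below -/
import Mathlib

section
/- Let γ>1, d∈{1,2,3}, C₀>0 and T>0. Suppose (h,u) is a C¹ solution of the diagonalized radially symmetric Euler system w_t+c₂w_r=−((d−1)/r)uh, z_t+c₁z_r=((d−1)/r)uh on (0,∞)×(0,T), with h(r,t)>0 for all r>0, h and u continuous up to r=0 with h(0,t)=u(0,t)=0, and such that through every point (r̄,t̄) with r̄>0, t̄∈(0,T) the backward 1- and 2-characteristics exist back to time 0 and remain in {r>0}. If the initial data satisfy 0 ≤ u₀(r)−(2/(γ−1))h₀(r) < u₀(r)+(2/(γ−1))h₀(r) ≤ 2C₀ for all r>0, then for all r>0 and 0<t<T one has 0 ≤ u(r,t)−(2/(γ−1))h(r,t) < u(r,t)+(2/(γ−1))h(r,t) ≤ 2C₀, i.e. 0 ≤ z < w ≤ 2C₀. -/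
/-- Comparison principle for linear differential inequalities with a continuous coefficient. -/
theorem nonneg_of_mul_le_deriv {b : ℝ} (hb : 0 ≤ b) {z z' a : ℝ → ℝ}
    (hz : ContinuousOn z (Set.Icc 0 b)) (ha : ContinuousOn a (Set.Icc 0 b))
    (hderiv : ∀ t ∈ Set.Ioo 0 b, HasDerivAt z (z' t) t)
    (hle : ∀ t ∈ Set.Ioo 0 b, a t * z t ≤ z' t) (h0 : 0 ≤ z 0) : 0 ≤ z b := by
  set α : ℝ → ℝ := Set.IccExtend hb ((Set.Icc 0 b).domRestrict a) with hα
  have hαc : Continuous α := (continuousOn_iff_continuous_domRestrict.1 ha).Icc_extend'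
  have hαeq : ∀ t ∈ Set.Icc 0 b, α t = a t := fun t ht => by
    rw [hα, Set.IccExtend_of_mem hb _ ht, Set.domRestrict_apply]
  have hA : ∀ t, HasDerivAt (fun s => ∫ x in (0 : ℝ)..s, α x) (α t) t := fun t =>
    intervalIntegral.integral_hasDerivAt_right (hαc.intervalIntegrable _ _)
      (hαc.stronglyMeasurableAtFilter _ _) hαc.continuousAt
  set A : ℝ → ℝ := fun s => ∫ x in (0 : ℝ)..s, α x
  have hAc : Continuous A := continuous_iff_continuousAt.2 fun t => (hA t).continuousAt
  have hmono : MonotoneOn (fun t => z t * Real.exp (-A t)) (Set.Icc 0 b) := by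
    refine monotoneOn_of_hasDerivWithinAt_nonneg (convex_Icc 0 b)
      (f' := fun t => z' t * Real.exp (-A t) + z t * (Real.exp (-A t) * -α t))
      (hz.mul (Real.continuous_exp.comp hAc.neg).continuousOn) ?_ ?_
    · intro t ht
      rw [interior_Icc] at ht
      exact ((hderiv t ht).mul (hA t).neg.exp).hasDerivWithinAt
    · intro t ht
      rw [interior_Icc] at ht
      rw [hαeq t (Set.Ioo_subset_Icc_self ht)]
      have := mul_nonneg (sub_nonneg.2 (hle t ht)) (Real.exp_pos (-A t)).le
      linarith
  have hcomp := hmono (Set.left_mem_Icc.2 hb) (Set.right_mem_Icc.2 hb) hb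
  have hb' : 0 ≤ z b * Real.exp (-A b) := (mul_nonneg h0 (Real.exp_pos _).le).trans hcomp
  exact nonneg_of_mul_nonneg_left hb' (Real.exp_pos _)

/-- Chain rule for a function of space and time along a curve, in terms of partial derivatives. -/
theorem hasDerivAt_along_curve {f : ℝ → ℝ → ℝ} {x : ℝ → ℝ} {v t : ℝ}
    (hf : DifferentiableAt ℝ (fun p : ℝ × ℝ => f p.1 p.2) (x t, t)) (hx : HasDerivAt x v t) :
    HasDerivAt (fun τ => f (x τ) τ)
      (deriv (fun τ => f (x t) τ) t + v * deriv (fun s => f s t) (x t)) t := by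
  obtain ⟨L, hL⟩ := hf
  have htime : HasDerivAt (fun τ => f (x t) τ) (L (0, 1)) t :=
    hL.comp_hasDerivAt t ((hasDerivAt_const t (x t)).prodMk (hasDerivAt_id t))
  have hspace : HasDerivAt (fun s => f s t) (L (1, 0)) (x t) :=
    hL.comp_hasDerivAt (f := fun s => (s, t)) (x t) ((hasDerivAt_id (x t)).prodMk (hasDerivAt_const (x t) t))
  have hcurve : HasDerivAt (fun τ => f (x τ) τ) (L (v, 1)) t :=
    hL.comp_hasDerivAt (f := fun τ => (x τ, τ)) t (hx.prodMk (hasDerivAt_id t))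
  rw [htime.deriv, hspace.deriv]
  convert hcurve using 1
  rw [← smul_eq_mul, ← map_smul, ← map_add]
  simp

/-- **Invariant region for the Riemann invariants of expanding radially symmetric waves.**
Let `(h,u)` be a C¹ solution of the diagonalized radially symmetric Euler system
`w_t + c₂ w_r = −((d−1)/r)uh`, `z_t + c₁ z_r = ((d−1)/r)uh` (with `w = u + 2h/(γ−1)`,
`z = u − 2h/(γ−1)`, `c₁ = u−h`, `c₂ = u+h`) on `(0,∞)×(0,T)`, with `h > 0` for `r > 0`,
`h(0,t) = u(0,t) = 0`, continuity up to `t = 0` and `r = 0`, and such that backward 1- and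
2-characteristics through any point exist back to time `0` and stay in `{r > 0}`.  If
`0 ≤ z₀ < w₀ ≤ 2C₀` initially, then `0 ≤ z < w ≤ 2C₀` for all `r > 0`, `0 < t < T`. -/
theorem riemann_invariant_region
    (γ : ℝ) (d : ℕ) (C0 T : ℝ)
    (hγ : 1 < γ) (hd : d = 1 ∨ d = 2 ∨ d = 3) (hC0 : 0 < C0) (hT : 0 < T)
    (u h : ℝ → ℝ → ℝ)
    (hC1 : ContDiffOn ℝ 1 (fun p : ℝ × ℝ => (u p.1 p.2, h p.1 p.2))
      (Set.Ioi (0:ℝ) ×ˢ Set.Ioo (0:ℝ) T))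
    (hcont : ContinuousOn (fun p : ℝ × ℝ => (u p.1 p.2, h p.1 p.2))
      (Set.Ici (0:ℝ) ×ˢ Set.Ico (0:ℝ) T))
    (hpos : ∀ r t, 0 < r → 0 < t → t < T → 0 < h r t)
    (hbdry : ∀ t, 0 ≤ t → t < T → h 0 t = 0 ∧ u 0 t = 0)
    (hpde_w : ∀ r t, 0 < r → 0 < t → t < T →
      deriv (fun τ => u r τ + 2 / (γ - 1) * h r τ) t
        + (u r t + h r t) * deriv (fun s => u s t + 2 / (γ - 1) * h s t) r
        = -(((d : ℝ) - 1) / r) * u r t * h r t)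
    (hpde_z : ∀ r t, 0 < r → 0 < t → t < T →
      deriv (fun τ => u r τ - 2 / (γ - 1) * h r τ) t
        + (u r t - h r t) * deriv (fun s => u s t - 2 / (γ - 1) * h s t) r
        = ((d : ℝ) - 1) / r * u r t * h r t)
    (hchar : ∀ rbar tbar, 0 < rbar → 0 < tbar → tbar < T →
      (∃ r1 : ℝ → ℝ, r1 tbar = rbar ∧ ∀ t ∈ Set.Icc 0 tbar,
          0 < r1 t ∧ HasDerivAt r1 (u (r1 t) t - h (r1 t) t) t) ∧
      (∃ r2 : ℝ → ℝ, r2 tbar = rbar ∧ ∀ t ∈ Set.Icc 0 tbar,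
          0 < r2 t ∧ HasDerivAt r2 (u (r2 t) t + h (r2 t) t) t))
    (hinit : ∀ r, 0 < r →
      0 ≤ u r 0 - 2 / (γ - 1) * h r 0 ∧
      u r 0 - 2 / (γ - 1) * h r 0 < u r 0 + 2 / (γ - 1) * h r 0 ∧
      u r 0 + 2 / (γ - 1) * h r 0 ≤ 2 * C0) :
    ∀ r t, 0 < r → 0 < t → t < T →
      0 ≤ u r t - 2 / (γ - 1) * h r t ∧
      u r t - 2 / (γ - 1) * h r t < u r t + 2 / (γ - 1) * h r t ∧
      u r t + 2 / (γ - 1) * h r t ≤ 2 * C0 := by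
  have hk : 0 < 2 / (γ - 1) := div_pos two_pos (sub_pos.2 hγ)
  set k : ℝ := 2 / (γ - 1)
  have hm : 0 ≤ (d : ℝ) - 1 := by rcases hd with rfl | rfl | rfl <;> norm_num
  set m : ℝ := (d : ℝ) - 1
  have hdiff : ∀ r t, 0 < r → 0 < t → t < T →
      DifferentiableAt ℝ (fun p : ℝ × ℝ => u p.1 p.2) (r, t) ∧
      DifferentiableAt ℝ (fun p : ℝ × ℝ => h p.1 p.2) (r, t) := by
    intro r t hr ht htT
    have hmem : Set.Ioi (0 : ℝ) ×ˢ Set.Ioo (0 : ℝ) T ∈ nhds (r, t) :=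
      (isOpen_Ioi.prod isOpen_Ioo).mem_nhds ⟨hr, ht, htT⟩
    have := (hC1.contDiffAt hmem).differentiableAt one_ne_zero
    exact ⟨this.fst, this.snd⟩
  have hcurve : ∀ (x : ℝ → ℝ) (b : ℝ), b < T → ContinuousOn x (Set.Icc 0 b) →
      (∀ t ∈ Set.Icc 0 b, 0 < x t) →
      ContinuousOn (fun t => u (x t) t) (Set.Icc 0 b) ∧
      ContinuousOn (fun t => h (x t) t) (Set.Icc 0 b) := by
    intro x b hb hx hxpos
    have := hcont.comp (hx.prodMk continuousOn_id)
      fun t ht => ⟨(hxpos t ht).le, ht.1, ht.2.trans_lt hb⟩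
    exact ⟨this.fst, this.snd⟩
  have hz : ∀ r t, 0 < r → 0 < t → t < T → 0 ≤ u r t - k * h r t := by
    intro r b hr hb hbT
    obtain ⟨⟨x, rfl, hx⟩, -⟩ := hchar r b hr hb hbT
    have hxc : ContinuousOn x (Set.Icc 0 b) := fun t ht =>
      (hx t ht).2.continuousAt.continuousWithinAt
    obtain ⟨huc, hhc⟩ := hcurve x b hbT hxc fun t ht => (hx t ht).1
    refine nonneg_of_mul_le_deriv hb.le (z := fun t => u (x t) t - k * h (x t) t)
      (z' := fun t => m / x t * u (x t) t * h (x t) t) (a := fun t => m / x t * h (x t) t)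
      (huc.sub (continuousOn_const.mul hhc))
      ((continuousOn_const.div hxc fun t ht => (hx t ht).1.ne').mul hhc) ?_ ?_
      (hinit _ (hx 0 (Set.left_mem_Icc.2 hb.le)).1).1
    · intro t ht
      obtain ⟨hxpos, hxd⟩ := hx t (Set.Ioo_subset_Icc_self ht)
      have htT := ht.2.trans hbT
      obtain ⟨hud, hhd⟩ := hdiff (x t) t hxpos ht.1 htT
      rw [← hpde_z (x t) t hxpos ht.1 htT]
      exact hasDerivAt_along_curve (f := fun r t => u r t - k * h r t)
        (hud.sub (hhd.const_mul k)) hxd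
    · intro t ht
      have hxpos := (hx t (Set.Ioo_subset_Icc_self ht)).1
      have : 0 ≤ m / x t * (k * h (x t) t ^ 2) := by positivity
      linarith
  intro r b hr hb hbT
  have hh := hpos r b hr hb hbT
  refine ⟨hz r b hr hb hbT, by nlinarith [mul_pos hk hh], ?_⟩
  obtain ⟨-, x, rfl, hx⟩ := hchar r b hr hb hbT
  have hxc : ContinuousOn x (Set.Icc 0 b) := fun t ht =>
    (hx t ht).2.continuousAt.continuousWithinAt
  obtain ⟨huc, hhc⟩ := hcurve x b hbT hxc fun t ht => (hx t ht).1
  have hanti : AntitoneOn (fun t => u (x t) t + k * h (x t) t) (Set.Icc 0 b) := by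
    refine antitoneOn_of_hasDerivWithinAt_nonpos (convex_Icc 0 b)
      (f' := fun t => -(m / x t) * u (x t) t * h (x t) t)
      (huc.add (continuousOn_const.mul hhc)) ?_ ?_
    · intro t ht
      rw [interior_Icc] at ht
      obtain ⟨hxpos, hxd⟩ := hx t (Set.Ioo_subset_Icc_self ht)
      have htT := ht.2.trans hbT
      obtain ⟨hud, hhd⟩ := hdiff (x t) t hxpos ht.1 htT
      rw [← hpde_w (x t) t hxpos ht.1 htT]
      exact (hasDerivAt_along_curve (f := fun r t => u r t + k * h r t)
        (hud.add (hhd.const_mul k)) hxd).hasDerivWithinAt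
    · intro t ht
      rw [interior_Icc] at ht
      have hxpos := (hx t (Set.Ioo_subset_Icc_self ht)).1
      have htT := ht.2.trans hbT
      have hht := hpos (x t) t hxpos ht.1 htT
      have hut : 0 ≤ u (x t) t := by linarith [hz (x t) t hxpos ht.1 htT, mul_pos hk hht]
      have : 0 ≤ m / x t * u (x t) t * h (x t) t := by positivity
      linarith
  exact (hanti (Set.left_mem_Icc.2 hb.le) (Set.right_mem_Icc.2 hb.le) hb.le).trans
    (hinit _ (hx 0 (Set.left_mem_Icc.2 hb.le)).1).2.2
end

section
/- Let 5/3<γ<3, d∈{2,3}, and let (v,u,r) be a C¹ Lagrangian solution of the compressible Euler system on (0,∞)×[0,T) arising from initial data satisfying Assumption (A) with constant C₀; in particular 0 < A(r)^{−(γ−1)/2}η ≤ u ≤ 2C₀ holds for x′>0 and r is nondecreasing along forward and backward characteristics. Fix x̄′>0, let Ω be the domain of dependence to the right of the forward characteristic through (x̄′,0), and let N(x̄′) be as in the context. Then max{α̃(x′,t′), β̃(x′,t′)} < N(x̄′) for all (x′,t′)∈Ω with 0<t′<T, where the bound N(x̄′) is independent of T. -/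
noncomputable section

/-- `A(r) = r^{d−1}`. -/
def Afun (d : ℕ) (r : ℝ) : ℝ := r ^ ((d : ℝ) - 1)

/-- `Ȧ(r) = (d−1) r^{d−2}`. -/
def AdotF (d : ℕ) (r : ℝ) : ℝ := ((d : ℝ) - 1) * r ^ ((d : ℝ) - 2)

/-- The density `ρ = 1/(A(r)v)` of a Lagrangian solution. -/
def rhoF (d : ℕ) (v r : ℝ → ℝ → ℝ) (x t : ℝ) : ℝ := (Afun d (r x t) * v x t)⁻¹

/-- `η = (2√(Kγ)/(γ−1)) A(r)^{(γ−1)/2} ρ^{(γ−1)/2}`. -/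
def etaF (K γ : ℝ) (d : ℕ) (v r : ℝ → ℝ → ℝ) (x t : ℝ) : ℝ :=
  2 * Real.sqrt (K * γ) / (γ - 1) * Afun d (r x t) ^ ((γ - 1) / 2) *
    rhoF d v r x t ^ ((γ - 1) / 2)

/-- `K_τ = (2√(Kγ)/(γ−1))^{2/(γ−1)}`. -/
def Ktau (K γ : ℝ) : ℝ := (2 * Real.sqrt (K * γ) / (γ - 1)) ^ (2 / (γ - 1))

/-- `K_c = √(Kγ) K_τ^{−(γ+1)/2}`. -/
def Kcc (K γ : ℝ) : ℝ := Real.sqrt (K * γ) * Ktau K γ ^ (-(γ + 1) / 2)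

/-- The Lagrangian wave speed `C = K_c A^{−(γ−1)/2} η^{(γ+1)/(γ−1)}`. -/
def Cw (K γ : ℝ) (d : ℕ) (v r : ℝ → ℝ → ℝ) (x t : ℝ) : ℝ :=
  Kcc K γ * Afun d (r x t) ^ (-(γ - 1) / 2) * etaF K γ d v r x t ^ ((γ + 1) / (γ - 1))

/-- The gradient variable `α = u_{x′} + A^{−(γ−1)/2} η_{x′}`. -/
def alphaF (K γ : ℝ) (d : ℕ) (v u r : ℝ → ℝ → ℝ) (x t : ℝ) : ℝ :=
  deriv (fun s => u s t) x +
    Afun d (r x t) ^ (-(γ - 1) / 2) * deriv (fun s => etaF K γ d v r s t) x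

/-- The gradient variable `β = u_{x′} − A^{−(γ−1)/2} η_{x′}`. -/
def betaF (K γ : ℝ) (d : ℕ) (v u r : ℝ → ℝ → ℝ) (x t : ℝ) : ℝ :=
  deriv (fun s => u s t) x -
    Afun d (r x t) ^ (-(γ - 1) / 2) * deriv (fun s => etaF K γ d v r s t) x

/-- The weighted gradient variable `α̃ = η^{(3−γ)/(γ−1)} α`. -/
def alphaT (K γ : ℝ) (d : ℕ) (v u r : ℝ → ℝ → ℝ) (x t : ℝ) : ℝ :=
  etaF K γ d v r x t ^ ((3 - γ) / (γ - 1)) * alphaF K γ d v u r x t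

/-- The weighted gradient variable `β̃ = η^{(3−γ)/(γ−1)} β`. -/
def betaT (K γ : ℝ) (d : ℕ) (v u r : ℝ → ℝ → ℝ) (x t : ℝ) : ℝ :=
  etaF K γ d v r x t ^ ((3 - γ) / (γ - 1)) * betaF K γ d v u r x t

/-- A C¹ Lagrangian solution `(v,u,r)` of the compressible Euler system
`v_{t′} = u_{x′}`, `u_{t′} + A(r) p_{x′} = 0`, `r_{x′} = v`, `r_{t′} = u`
(`p = Kρ^γ`, `ρ = 1/(A(r)v)`) on `(0,∞) × S`, with `v > 0`, `r > 0`. -/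
def LagSoln (K γ : ℝ) (d : ℕ) (v u r : ℝ → ℝ → ℝ) (S : Set ℝ) : Prop :=
  ContDiffOn ℝ 1 (fun p : ℝ × ℝ => (v p.1 p.2, u p.1 p.2, r p.1 p.2))
    (Set.Ioi (0:ℝ) ×ˢ S) ∧
  ∀ x t, 0 < x → t ∈ S →
    0 < v x t ∧ 0 < r x t ∧
    deriv (fun τ => v x τ) t = deriv (fun s => u s t) x ∧
    deriv (fun τ => u x τ) t
      + Afun d (r x t) * deriv (fun s => K * rhoF d v r s t ^ γ) x = 0 ∧
    deriv (fun s => r s t) x = v x t ∧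
    deriv (fun τ => r x τ) t = u x t

/-- The propagated supersonic a priori bounds `0 < A^{−(γ−1)/2}η ≤ u ≤ 2C₀` for `x′ > 0`. -/
def Supersonic (K γ C0 : ℝ) (d : ℕ) (v u r : ℝ → ℝ → ℝ) (S : Set ℝ) : Prop :=
  ∀ x t, 0 < x → t ∈ S →
    0 < Afun d (r x t) ^ (-(γ - 1) / 2) * etaF K γ d v r x t ∧
    Afun d (r x t) ^ (-(γ - 1) / 2) * etaF K γ d v r x t ≤ u x t ∧
    u x t ≤ 2 * C0

/-- **Assumption (A)** on the Eulerian initial data `(ρ₀,u₀)`. -/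
def AssumptionA (K γ C0 : ℝ) (ρ0 u0 : ℝ → ℝ) : Prop :=
  ContDiffOn ℝ 1 (fun s => (ρ0 s, u0 s)) (Set.Ici 0) ∧
  (∃ f g : ℝ → ℝ, ContDiffOn ℝ 1 f (Set.Ico 0 1) ∧ ContDiffOn ℝ 1 g (Set.Ico 0 1) ∧
    ∀ s, 0 < s → s < 1 → f s = ρ0 s ^ ((γ - 1) / 2) / s ∧ g s = u0 s / s) ∧
  (∀ s, 0 < s →
    0 < 2 * Real.sqrt (K * γ) / (γ - 1) * ρ0 s ^ ((γ - 1) / 2) ∧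
    2 * Real.sqrt (K * γ) / (γ - 1) * ρ0 s ^ ((γ - 1) / 2) ≤ u0 s ∧ u0 s ≤ C0) ∧
  ρ0 0 = 0 ∧ u0 0 = 0

/-- The Lagrangian solution arises from Eulerian initial data satisfying Assumption (A). -/
def FromAssumptionA (K γ C0 : ℝ) (d : ℕ) (v u r : ℝ → ℝ → ℝ) : Prop :=
  ∃ ρ0 u0 : ℝ → ℝ, AssumptionA K γ C0 ρ0 u0 ∧
    ∀ x, 0 < x → ρ0 (r x 0) = rhoF d v r x 0 ∧ u0 (r x 0) = u x 0

/-- Membership in the domain of dependence `Ω` to the right of the forward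
characteristic `x⁺` issued from `(x̄′,0)` (with `dx⁺/dt′ = C`, `x⁺(0) = x̄′`). -/
def InOmega (K γ : ℝ) (d : ℕ) (v r : ℝ → ℝ → ℝ) (xb x t : ℝ) : Prop :=
  0 ≤ t ∧ ∃ xp : ℝ → ℝ, xp 0 = xb ∧
    (∀ s ∈ Set.Icc 0 t, HasDerivAt xp (Cw K γ d v r (xp s) s) s) ∧ xp t ≤ x

/-- `K̂(x̄′) = ((γ−1)(3γ−5)(d−1)/8) r(x̄′,0)^{(d(1−γ)+γ−3)/2}`. -/
def Khat (γ : ℝ) (d : ℕ) (r : ℝ → ℝ → ℝ) (xb : ℝ) : ℝ :=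
  (γ - 1) * (3 * γ - 5) * ((d : ℝ) - 1) / 8 *
    r xb 0 ^ (((d : ℝ) * (1 - γ) + γ - 3) / 2)

section

open Filter Topology Set

/-- The space-time strip `(0,∞) × [0,T)`. -/
def strip (T : ℝ) : Set (ℝ × ℝ) := Ioi 0 ×ˢ Ico 0 T

/-- `f` is `C¹` in space on the strip, with continuous spatial derivative `fx`, and for positive
times it satisfies the chain rule along curves, with time derivative `ft`. -/
structure StripC1 (T : ℝ) (f fx ft : ℝ → ℝ → ℝ) : Prop where
  cont : ContinuousOn (fun p : ℝ × ℝ => f p.1 p.2) (strip T)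
  contx : ContinuousOn (fun p : ℝ × ℝ => fx p.1 p.2) (strip T)
  hasx : ∀ x t, 0 < x → t ∈ Ico 0 T → HasDerivAt (fun s => f s t) (fx x t) x
  chain : ∀ x t X X', 0 < x → t ∈ Ioo 0 T → X t = x → HasDerivAt X X' t →
    HasDerivAt (fun s => f (X s) s) (ft x t + X' * fx x t) t

theorem StripC1.of_contDiffOn {T : ℝ} {f : ℝ → ℝ → ℝ}
    (hf : ContDiffOn ℝ 1 (fun p : ℝ × ℝ => f p.1 p.2) (strip T)) :
    StripC1 T f (fun x t => deriv (fun s => f s t) x) (fun x t => deriv (fun s => f x s) t) := by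
  have hudiff : UniqueDiffOn ℝ (strip T) :=
    (isOpen_Ioi.uniqueDiffOn).prod (uniqueDiffOn_Ico 0 T)
  have hx : ∀ x t, 0 < x → t ∈ Ico 0 T → HasDerivAt (fun s => f s t)
      (fderivWithin ℝ (fun p : ℝ × ℝ => f p.1 p.2) (strip T) (x, t) (1, 0)) x := by
    intro x t hx ht
    have h1 := (hf.differentiableOn one_ne_zero (x, t) ⟨hx, ht⟩).hasFDerivWithinAt
    have h2 : HasDerivWithinAt (fun s : ℝ => (s, t)) ((1 : ℝ), (0 : ℝ)) (Ioi 0) x :=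
      ((hasDerivAt_id x).prodMk (hasDerivAt_const x t)).hasDerivWithinAt
    have h3 := HasFDerivWithinAt.comp_hasDerivWithinAt x h1 h2 
      (t := strip T) (fun s hs => ⟨hs, ht⟩)
    exact h3.hasDerivAt (Ioi_mem_nhds hx)
  refine ⟨hf.continuousOn, ?_, fun x t hx0 ht => ?_, fun x t X X' hx0 ht hXt hX => ?_⟩
  · refine ((hf.continuousOn_fderivWithin hudiff le_rfl).clm_apply
      (continuousOn_const (c := ((1 : ℝ), (0 : ℝ))))).congr fun p hp => ?_
    exact (hx p.1 p.2 hp.1 hp.2).deriv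
  · exact (hx x t hx0 ht).differentiableAt.hasDerivAt
  · have hnhds : strip T ∈ 𝓝 (x, t) :=
      prod_mem_nhds (Ioi_mem_nhds hx0) (Ico_mem_nhds ht.1 ht.2)
    have hF := ((hf.differentiableOn one_ne_zero (x, t)
      ⟨hx0, Ioo_subset_Ico_self ht⟩).differentiableAt hnhds).hasFDerivAt
    set F := fderiv ℝ (fun p : ℝ × ℝ => f p.1 p.2) (x, t)
    have e1 : deriv (fun s => f s t) x = F (1, 0) := by
      have := HasFDerivAt.comp_hasDerivAt x (f := fun s : ℝ => (s, t)) hF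
        ((hasDerivAt_id x).prodMk (hasDerivAt_const x t))
      exact this.deriv
    have e2 : deriv (fun s => f x s) t = F (0, 1) := by
      have := HasFDerivAt.comp_hasDerivAt t (f := fun s : ℝ => (x, s)) hF
        ((hasDerivAt_const t x).prodMk (hasDerivAt_id t))
      exact this.deriv
    have h3 := HasFDerivAt.comp_hasDerivAt t (f := fun s : ℝ => (X s, s))
      (by simpa only [hXt] using hF) (hX.prodMk (hasDerivAt_id t))
    have e3 : F (X', 1) = deriv (fun s => f x s) t + X' * deriv (fun s => f s t) x := by
      rw [e1, e2, ← smul_eq_mul, ← map_smul, ← map_add]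
      simp
    exact e3 ▸ h3

/-- Joint convergence of forward difference quotients to the spatial derivative. -/
theorem tendsto_diffQuot {T : ℝ} {f fx : ℝ → ℝ → ℝ}
    (hcont : ContinuousOn (fun p : ℝ × ℝ => fx p.1 p.2) (strip T))
    (hasx : ∀ x t, 0 < x → t ∈ Ico 0 T → HasDerivAt (fun s => f s t) (fx x t) x)
    {p : ℝ × ℝ} (hp : p ∈ strip T) :
    Tendsto (fun z : ℝ × ℝ × ℝ => (f (z.2.1 + z.1) z.2.2 - f z.2.1 z.2.2) / z.1)
      (𝓝[>] 0 ×ˢ 𝓝[strip T] p) (𝓝 (fx p.1 p.2)) := by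
  rw [Metric.tendsto_nhds]
  intro ε hε
  obtain ⟨δ, hδ, hδp⟩ := Metric.continuousWithinAt_iff.1 (hcont p hp) ε hε
  have h1 : ∀ᶠ h in 𝓝[>] (0 : ℝ), 0 < h ∧ h < δ / 2 := by
    filter_upwards [Ioo_mem_nhdsGT (half_pos hδ)] with h hh using hh
  have h2 : ∀ᶠ q in 𝓝[strip T] p, dist q p < δ / 2 ∧ q ∈ strip T := by
    filter_upwards [mem_nhdsWithin_of_mem_nhds (Metric.ball_mem_nhds p (half_pos hδ)),
      self_mem_nhdsWithin] with q hq hq' using ⟨hq, hq'⟩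
  filter_upwards [h1.prod_mk h2] with ⟨h, x, t⟩ ⟨⟨hh0, hh⟩, hq, hx, ht⟩
  simp only at hh0 hh hq hx ht ⊢
  have hx : 0 < x := hx
  obtain ⟨ξ, hξ, hξ'⟩ := exists_hasDerivAt_eq_slope (fun s => f s t) (fun s => fx s t)
    (show x < x + h by linarith)
    (fun s hs => (hasx s t (hx.trans_le hs.1) ht).continuousAt.continuousWithinAt)
    (fun s hs => hasx s t (hx.trans hs.1) ht)
  rw [add_sub_cancel_left] at hξ'
  rw [← hξ']
  refine hδp (x := (ξ, t)) ⟨hx.trans hξ.1, ht⟩ ?_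
  calc dist (ξ, t) p ≤ dist (ξ, t) (x, t) + dist (x, t) p := dist_triangle _ _ _
    _ < δ / 2 + δ / 2 := by
        refine add_lt_add ?_ hq
        rw [Prod.dist_eq, dist_self, Real.dist_eq, abs_of_pos (by linarith [hξ.1])]
        exact max_lt (by linarith [hξ.2]) (half_pos hδ)
    _ = δ := add_halves δ

theorem tendsto_shift {T : ℝ} {f : ℝ → ℝ → ℝ}
    (hcont : ContinuousOn (fun p : ℝ × ℝ => f p.1 p.2) (strip T))
    {p : ℝ × ℝ} (hp : p ∈ strip T) :
    Tendsto (fun z : ℝ × ℝ × ℝ => f (z.2.1 + z.1) z.2.2)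
      (𝓝[>] 0 ×ˢ 𝓝[strip T] p) (𝓝 (f p.1 p.2)) := by
  have key : Tendsto (fun z : ℝ × ℝ × ℝ => (z.2.1 + z.1, z.2.2))
      (𝓝[>] 0 ×ˢ 𝓝[strip T] p) (𝓝[strip T] p) := by
    refine tendsto_nhdsWithin_iff.2 ⟨?_, ?_⟩
    · have hc : Continuous (fun z : ℝ × ℝ × ℝ => (z.2.1 + z.1, z.2.2)) := by fun_prop
      have := hc.tendsto (0, p)
      simp only [add_zero] at this
      refine this.mono_left ?_
      rw [nhds_prod_eq]
      exact Filter.prod_mono nhdsWithin_le_nhds nhdsWithin_le_nhds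
    · have h1 : ∀ᶠ h in 𝓝[>] (0 : ℝ), 0 < h := self_mem_nhdsWithin
      have h2 : ∀ᶠ q in 𝓝[strip T] p, q ∈ strip T := self_mem_nhdsWithin
      filter_upwards [h1.prod_mk h2] with ⟨h, x, t⟩ ⟨hh, hx, ht⟩
      exact ⟨add_pos hx hh, ht⟩
  exact (hcont p hp).tendsto.comp key

theorem tendsto_unshifted {T : ℝ} {f : ℝ → ℝ → ℝ}
    (hcont : ContinuousOn (fun p : ℝ × ℝ => f p.1 p.2) (strip T))
    {p : ℝ × ℝ} (hp : p ∈ strip T) :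
    Tendsto (fun z : ℝ × ℝ × ℝ => f z.2.1 z.2.2)
      (𝓝[>] 0 ×ˢ 𝓝[strip T] p) (𝓝 (f p.1 p.2)) :=
  (hcont p hp).tendsto.comp tendsto_snd

/-- Forward difference quotient in space with step `h`. -/
def diffQuot (f : ℝ → ℝ → ℝ) (h x t : ℝ) : ℝ := (f (x + h) t - f x t) / h

/-- The Euler system in Lagrangian coordinates, written for the Eulerian sound speed `c`
(or its negative), with `D = d - 1` and `vx`, `ux` the spatial derivatives of `v`, `u`. -/
structure EulerStrip (γ D T : ℝ) (v u r c vx ux : ℝ → ℝ → ℝ) : Prop where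
  hv : StripC1 T v vx ux
  hu : StripC1 T u ux (fun x t => (c x t / v x t) ^ 2 * vx x t + D * c x t ^ 2 / r x t)
  hr : StripC1 T r v u
  hc : StripC1 T c
    (fun x t => -c x t * (D * (γ - 1) / 2 * v x t / r x t + (γ - 1) / 2 * vx x t / v x t))
    (fun x t => -c x t * (D * (γ - 1) / 2 * u x t / r x t + (γ - 1) / 2 * ux x t / v x t))
  vpos : ∀ x t, 0 < x → t ∈ Ico 0 T → 0 < v x t
  rpos : ∀ x t, 0 < x → t ∈ Ico 0 T → 0 < r x t

theorem EulerStrip.neg {γ D T : ℝ} {v u r c vx ux : ℝ → ℝ → ℝ}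
    (E : EulerStrip γ D T v u r c vx ux) :
    EulerStrip γ D T v u r (fun x t => -c x t) vx ux where
  hv := E.hv
  hu := by simpa only [neg_div, neg_sq] using E.hu
  hr := E.hr
  hc :=
    { cont := E.hc.cont.neg
      contx := E.hc.contx.neg.congr fun p _ => by simp only [Pi.neg_apply]; ring
      hasx := fun x t hx ht => by
        exact (E.hc.hasx x t hx ht).neg.congr_deriv (by ring)
      chain := fun x t X X' hx ht hX hX' => by
        exact (E.hc.chain x t X X' hx ht hX hX').neg.congr_deriv (by ring) }
  vpos := E.vpos
  rpos := E.rpos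

/-- The rate of change along a characteristic of the weighted gradient variable built from a
difference quotient `φ` of the Riemann invariant; `gq` and `Cq` are the difference quotients of
the source term and of the wave speed, `ws` is the shifted derivative of the Riemann invariant. -/
def gradRate (γ D v u r c vx ux φ gq Cq ws : ℝ) : ℝ :=
  (ux + c / v * vx) * (-((3 - γ) / 2)) * v ^ (-((3 - γ) / 2) - 1) * (φ + D * c * v / r) +
    v ^ (-((3 - γ) / 2)) * (gq - Cq * ws +
      ((D * (-c * (D * (γ - 1) / 2 * (u + c) / r + (γ - 1) / 2 * (ux + c / v * vx) / v)) * v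
        + D * c * (ux + c / v * vx)) * r - D * c * v * (u + c)) / r ^ 2)

theorem EulerStrip.hasDerivAt_along {γ D T : ℝ} {v u r c vx ux : ℝ → ℝ → ℝ}
    (E : EulerStrip γ D T v u r c vx ux) (hγ : 1 < γ) {h x t : ℝ} {X : ℝ → ℝ} (hh : 0 < h)
    (hx : 0 < x) (ht : t ∈ Ioo 0 T) (hX : X t = x) (hX' : HasDerivAt X (c x t / v x t) t) :
    HasDerivAt (fun s => v (X s) s ^ (-((3 - γ) / 2)) *
      (diffQuot (fun x t => u x t + 2 / (γ - 1) * c x t) h (X s) s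
        + D * c (X s) s * v (X s) s / r (X s) s))
      (gradRate γ D (v x t) (u x t) (r x t) (c x t) (vx x t) (ux x t)
        (diffQuot (fun x t => u x t + 2 / (γ - 1) * c x t) h x t)
        (diffQuot (fun x t => -D * c x t * u x t / r x t) h x t)
        (diffQuot (fun x t => c x t / v x t) h x t)
        (ux (x + h) t + 2 / (γ - 1) * (-c (x + h) t * (D * (γ - 1) / 2 * v (x + h) t / r (x + h) t
          + (γ - 1) / 2 * vx (x + h) t / v (x + h) t)))) t := by
  have htI := Ioo_subset_Ico_self ht
  have hxh : 0 < x + h := add_pos hx hh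
  have v0 := E.vpos x t hx htI
  have r0 := E.rpos x t hx htI
  have v1 := E.vpos (x + h) t hxh htI
  have r1 := E.rpos (x + h) t hxh htI
  have hXh : HasDerivAt (fun s => X s + h) (c x t / v x t) t := hX'.add_const h
  have hv := E.hv.chain x t X _ hx ht hX hX'
  have hu := E.hu.chain x t X _ hx ht hX hX'
  have hr := E.hr.chain x t X _ hx ht hX hX'
  have hc := E.hc.chain x t X _ hx ht hX hX'
  have hu' := E.hu.chain (x + h) t _ _ hxh ht (by simp only [hX]) hXh
  have hc' := E.hc.chain (x + h) t _ _ hxh ht (by simp only [hX]) hXh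
  have e0 : γ - 1 ≠ 0 := by linarith
  have hφ := (((hu'.add (hc'.const_mul (2 / (γ - 1)))).sub
    (hu.add (hc.const_mul (2 / (γ - 1))))).div_const h)
  have hq := ((hc.const_mul D).mul hv).div hr (by rw [hX]; exact r0.ne')
  have hw := hv.rpow_const (p := -((3 - γ) / 2)) (Or.inl (by rw [hX]; exact v0.ne'))
  have := hw.mul (hφ.add hq)
  refine this.congr_deriv ?_
  simp only [gradRate, diffQuot, Pi.add_apply, Pi.sub_apply, Pi.mul_apply, Pi.div_apply, hX]
  congr 1
  congr 1
  generalize v (x + h) t = v1 at *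
  generalize r (x + h) t = r1 at *
  generalize c (x + h) t = c1 at *
  generalize u (x + h) t = u1 at *
  generalize vx (x + h) t = vx1 at *
  generalize ux (x + h) t = ux1 at *
  generalize v x t = v at *
  generalize r x t = r at *
  generalize c x t = c at *
  generalize u x t = u at *
  generalize vx x t = vx at *
  generalize ux x t = ux at *
  congr 1
  · field_simp
    ring
  · field_simp
    ring

/-- Limit value of `gradRate` as the step of the difference quotients tends to zero. -/
theorem gradRate_eq {γ D v u r c vx ux α β : ℝ} (hγ : 1 < γ) (hv : 0 < v) (hr : 0 < r)
    (hα : α = ux - c / v * vx) (hβ : β = ux + c / v * vx) :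
    gradRate γ D v u r c vx ux
      (ux + 2 / (γ - 1) * (-c * (D * (γ - 1) / 2 * v / r + (γ - 1) / 2 * vx / v)))
      (((-D * (-c * (D * (γ - 1) / 2 * v / r + (γ - 1) / 2 * vx / v)) * u + -D * c * ux) * r
        - -D * c * u * v) / r ^ 2)
      (((-c * (D * (γ - 1) / 2 * v / r + (γ - 1) / 2 * vx / v)) * v - c * vx) / v ^ 2)
      (ux + 2 / (γ - 1) * (-c * (D * (γ - 1) / 2 * v / r + (γ - 1) / 2 * vx / v))) =
    v ^ (-((3 - γ) / 2)) * (((3 * γ - 5) / 4 * α * β - (γ + 1) / 4 * α ^ 2) / v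
      + D * (γ - 1) / 4 * (u - 3 * c) * (β - α) / r - (D * (γ - 1) + 1) * D * c ^ 2 * v / r ^ 2) := by
  have e0 : γ - 1 ≠ 0 := by linarith
  rw [gradRate, Real.rpow_sub_one hv.ne', hα, hβ]
  generalize v ^ (-((3 - γ) / 2)) = V
  field_simp
  ring

/-- The weighted gradient variable, with the derivative of the Riemann invariant replaced by a
difference quotient of step `h`. -/
def weightedQuot (γ D : ℝ) (v u r c : ℝ → ℝ → ℝ) (h x t : ℝ) : ℝ :=
  v x t ^ (-((3 - γ) / 2)) *
    (diffQuot (fun x t => u x t + 2 / (γ - 1) * c x t) h x t + D * c x t * v x t / r x t)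

/-- The rate of change of `weightedQuot` along a characteristic. -/
def weightedQuotRate (γ D : ℝ) (v u r c vx ux : ℝ → ℝ → ℝ) (h x t : ℝ) : ℝ :=
  gradRate γ D (v x t) (u x t) (r x t) (c x t) (vx x t) (ux x t)
    (diffQuot (fun x t => u x t + 2 / (γ - 1) * c x t) h x t)
    (diffQuot (fun x t => -D * c x t * u x t / r x t) h x t)
    (diffQuot (fun x t => c x t / v x t) h x t)
    (ux (x + h) t + 2 / (γ - 1) * (-c (x + h) t * (D * (γ - 1) / 2 * v (x + h) t / r (x + h) t
      + (γ - 1) / 2 * vx (x + h) t / v (x + h) t)))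

theorem EulerStrip.tendsto_diffQuot_invariant {γ D T : ℝ} {v u r c vx ux : ℝ → ℝ → ℝ}
    (E : EulerStrip γ D T v u r c vx ux) {p : ℝ × ℝ} (hp : p ∈ strip T) :
    Tendsto (fun z : ℝ × ℝ × ℝ =>
        diffQuot (fun x t => u x t + 2 / (γ - 1) * c x t) z.1 z.2.1 z.2.2)
      (𝓝[>] 0 ×ˢ 𝓝[strip T] p)
      (𝓝 (ux p.1 p.2 + 2 / (γ - 1) * (-c p.1 p.2 * (D * (γ - 1) / 2 * v p.1 p.2 / r p.1 p.2
        + (γ - 1) / 2 * vx p.1 p.2 / v p.1 p.2)))) :=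
  tendsto_diffQuot (f := fun x t => u x t + 2 / (γ - 1) * c x t)
    (fx := fun x t => ux x t + 2 / (γ - 1) * (-c x t * (D * (γ - 1) / 2 * v x t / r x t
      + (γ - 1) / 2 * vx x t / v x t)))
    (E.hu.contx.add (continuousOn_const.mul E.hc.contx))
    (fun x t hx ht => (E.hu.hasx x t hx ht).add ((E.hc.hasx x t hx ht).const_mul _)) hp

theorem EulerStrip.tendsto_weightedQuot {γ D T : ℝ} {v u r c vx ux : ℝ → ℝ → ℝ}
    (E : EulerStrip γ D T v u r c vx ux) (hγ : 1 < γ) {p : ℝ × ℝ} (hp : p ∈ strip T) :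
    Tendsto (fun z : ℝ × ℝ × ℝ => weightedQuot γ D v u r c z.1 z.2.1 z.2.2)
      (𝓝[>] 0 ×ˢ 𝓝[strip T] p)
      (𝓝 (v p.1 p.2 ^ (-((3 - γ) / 2)) *
        (ux p.1 p.2 - c p.1 p.2 / v p.1 p.2 * vx p.1 p.2))) := by
  have v0 := E.vpos p.1 p.2 hp.1 hp.2
  have r0 := E.rpos p.1 p.2 hp.1 hp.2
  have tv := tendsto_unshifted E.hv.cont hp
  have tc := tendsto_unshifted E.hc.cont hp
  have tr := tendsto_unshifted E.hr.cont hp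
  have := (tv.rpow_const (p := -((3 - γ) / 2)) (Or.inl v0.ne')).mul
    ((E.tendsto_diffQuot_invariant hp).add (((tc.const_mul D).mul tv).div tr r0.ne'))
  refine (this.congr' (Eventually.of_forall fun _ => rfl)).trans_eq (congrArg 𝓝 ?_)
  congr 1
  have e0 : γ - 1 ≠ 0 := by linarith
  field_simp
  ring

theorem EulerStrip.tendsto_weightedQuotRate {γ D T : ℝ} {v u r c vx ux : ℝ → ℝ → ℝ}
    (E : EulerStrip γ D T v u r c vx ux) (hγ : 1 < γ) {p : ℝ × ℝ} (hp : p ∈ strip T)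
    {α β : ℝ} (hα : α = ux p.1 p.2 - c p.1 p.2 / v p.1 p.2 * vx p.1 p.2)
    (hβ : β = ux p.1 p.2 + c p.1 p.2 / v p.1 p.2 * vx p.1 p.2) :
    Tendsto (fun z : ℝ × ℝ × ℝ => weightedQuotRate γ D v u r c vx ux z.1 z.2.1 z.2.2)
      (𝓝[>] 0 ×ˢ 𝓝[strip T] p)
      (𝓝 (v p.1 p.2 ^ (-((3 - γ) / 2)) *
        (((3 * γ - 5) / 4 * α * β - (γ + 1) / 4 * α ^ 2) / v p.1 p.2
          + D * (γ - 1) / 4 * (u p.1 p.2 - 3 * c p.1 p.2) * (β - α) / r p.1 p.2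
          - (D * (γ - 1) + 1) * D * c p.1 p.2 ^ 2 * v p.1 p.2 / r p.1 p.2 ^ 2))) := by
  have v0 := E.vpos p.1 p.2 hp.1 hp.2
  have r0 := E.rpos p.1 p.2 hp.1 hp.2
  have tv := tendsto_unshifted E.hv.cont hp
  have tu := tendsto_unshifted E.hu.cont hp
  have tr := tendsto_unshifted E.hr.cont hp
  have tc := tendsto_unshifted E.hc.cont hp
  have tvx := tendsto_unshifted E.hv.contx hp
  have tux := tendsto_unshifted E.hu.contx hp
  have tφ := E.tendsto_diffQuot_invariant hp
  have tw := (tendsto_shift E.hu.contx hp).add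
    ((tendsto_shift (f := fun x t => -c x t * (D * (γ - 1) / 2 * v x t / r x t
      + (γ - 1) / 2 * vx x t / v x t)) E.hc.contx hp).const_mul (2 / (γ - 1)))
  have rne : ∀ q ∈ strip T, r q.1 q.2 ≠ 0 := fun q hq => (E.rpos _ _ hq.1 hq.2).ne'
  have vne : ∀ q ∈ strip T, v q.1 q.2 ≠ 0 := fun q hq => (E.vpos _ _ hq.1 hq.2).ne'
  have tg := tendsto_diffQuot (f := fun x t => -D * c x t * u x t / r x t)
    (fx := fun x t => ((-D * (-c x t * (D * (γ - 1) / 2 * v x t / r x t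
      + (γ - 1) / 2 * vx x t / v x t)) * u x t + -D * c x t * ux x t) * r x t
        - -D * c x t * u x t * v x t) / r x t ^ 2)
    (((((continuousOn_const (c := -D)).mul E.hc.contx).mul E.hu.cont).add
      ((continuousOn_const.mul E.hc.cont).mul E.hu.contx)).mul E.hr.cont |>.sub
        (((continuousOn_const.mul E.hc.cont).mul E.hu.cont).mul E.hv.cont) |>.div
        (E.hr.cont.pow 2) (fun q hq => pow_ne_zero 2 (rne q hq)))
    (fun x t hx ht => (((E.hc.hasx x t hx ht).const_mul (-D)).mul (E.hu.hasx x t hx ht)).div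
      (E.hr.hasx x t hx ht) (rne (x, t) ⟨hx, ht⟩)) hp
  have tC := tendsto_diffQuot (f := fun x t => c x t / v x t)
    (fx := fun x t => ((-c x t * (D * (γ - 1) / 2 * v x t / r x t
      + (γ - 1) / 2 * vx x t / v x t)) * v x t - c x t * vx x t) / v x t ^ 2)
    (((E.hc.contx.mul E.hv.cont).sub (E.hc.cont.mul E.hv.contx)).div
      (E.hv.cont.pow 2) (fun q hq => pow_ne_zero 2 (vne q hq)))
    (fun x t hx ht => (E.hc.hasx x t hx ht).div
      (E.hv.hasx x t hx ht) (vne (x, t) ⟨hx, ht⟩)) hp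
  rw [← gradRate_eq hγ v0 r0 hα hβ]
  have tV := tux.add ((tc.div tv v0.ne').mul tvx)
  have tc' := tc.neg.mul ((((tu.add tc).const_mul (D * (γ - 1) / 2)).div tr r0.ne').add
    ((tV.const_mul ((γ - 1) / 2)).div tv v0.ne'))
  exact (((tV.mul_const _).mul (tv.rpow_const (p := -((3 - γ) / 2) - 1) (Or.inl v0.ne'))).mul
    (tφ.add (((tc.const_mul D).mul tv).div tr r0.ne'))).add
    ((tv.rpow_const (p := -((3 - γ) / 2)) (Or.inl v0.ne')).mul ((tg.sub (tC.mul tw)).add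
    ((((((tc'.const_mul D).mul tv).add ((tc.const_mul D).mul tV)).mul tr).sub
      (((tc.const_mul D).mul tv).mul (tu.add tc))).div (tr.pow 2) (pow_ne_zero 2 r0.ne'))))

theorem riccati_neg {γ D v u r c α β : ℝ} (hγ1 : 1 < γ) (hγ2 : γ < 3) (hD : 0 < D)
    (hv : 0 < v) (hα : 0 < α) (hβ : β ≤ α)
    (hcond : 0 ≤ (3 * γ - 5) / 4 * (α / v) + D * (γ - 1) / 4 * ((u - 3 * c) / r)) :
    ((3 * γ - 5) / 4 * α * β - (γ + 1) / 4 * α ^ 2) / v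
      + D * (γ - 1) / 4 * (u - 3 * c) * (β - α) / r
      - (D * (γ - 1) + 1) * D * c ^ 2 * v / r ^ 2 < 0 := by
  have h1 : 0 < (3 - γ) / 2 * (α ^ 2 / v) := by
    have : 0 < 3 - γ := by linarith
    positivity
  have h2 : 0 ≤ (D * (γ - 1) + 1) * D * c ^ 2 * v / r ^ 2 := by
    have : 0 < γ - 1 := by linarith
    positivity
  have h3 := mul_nonneg (sub_nonneg.2 hβ) hcond
  have h4 : ((3 * γ - 5) / 4 * α * β - (γ + 1) / 4 * α ^ 2) / v
      + D * (γ - 1) / 4 * (u - 3 * c) * (β - α) / r =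
      -((α - β) * ((3 * γ - 5) / 4 * (α / v) + D * (γ - 1) / 4 * ((u - 3 * c) / r)))
        - (3 - γ) / 2 * (α ^ 2 / v) := by
    ring
  linarith

theorem EulerStrip.eventually_weightedQuotRate_neg {γ D T n : ℝ} {v u r c vx ux : ℝ → ℝ → ℝ}
    (E : EulerStrip γ D T v u r c vx ux) (hγ1 : 1 < γ) (hγ2 : γ < 3) (hD : 0 < D) (hn : 0 < n)
    {p : ℝ × ℝ} (hp : p ∈ strip T)
    (hcond : 0 ≤ (3 * γ - 5) / 4 * (n * v p.1 p.2 ^ ((3 - γ) / 2) / v p.1 p.2)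
      + D * (γ - 1) / 4 * ((u p.1 p.2 - 3 * c p.1 p.2) / r p.1 p.2)) :
    ∀ᶠ z : ℝ × ℝ × ℝ in 𝓝[>] 0 ×ˢ 𝓝[strip T] p,
      weightedQuot γ D v u r c z.1 z.2.1 z.2.2 = n →
      weightedQuot γ D v u r (fun x t => -c x t) z.1 z.2.1 z.2.2 ≤ n →
      weightedQuotRate γ D v u r c vx ux z.1 z.2.1 z.2.2 < 0 := by
  have v0 := E.vpos p.1 p.2 hp.1 hp.2
  have tA := E.tendsto_weightedQuot hγ1 hp
  have tB := E.neg.tendsto_weightedQuot hγ1 hp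
  have tR := E.tendsto_weightedQuotRate hγ1 hp rfl rfl
  by_cases hA : v p.1 p.2 ^ (-((3 - γ) / 2)) *
      (ux p.1 p.2 - c p.1 p.2 / v p.1 p.2 * vx p.1 p.2) = n
  swap
  · filter_upwards [tA.eventually_ne hA] with z hz h using absurd h hz
  by_cases hB : v p.1 p.2 ^ (-((3 - γ) / 2)) *
      (ux p.1 p.2 - -c p.1 p.2 / v p.1 p.2 * vx p.1 p.2) ≤ n
  swap
  · filter_upwards [tB.eventually_const_lt (not_le.1 hB)] with z hz _ h using absurd hz h.not_gt
  have hw := Real.rpow_pos_of_pos v0 ((3 - γ) / 2)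
  rw [Real.rpow_neg v0.le] at hA hB
  have hα : ux p.1 p.2 - c p.1 p.2 / v p.1 p.2 * vx p.1 p.2 =
      n * v p.1 p.2 ^ ((3 - γ) / 2) := by
    rw [← hA]; field_simp
  have hβ : ux p.1 p.2 + c p.1 p.2 / v p.1 p.2 * vx p.1 p.2 ≤
      n * v p.1 p.2 ^ ((3 - γ) / 2) := by
    rw [inv_mul_le_iff₀ hw] at hB
    linarith [hB, show -c p.1 p.2 / v p.1 p.2 * vx p.1 p.2 =
      -(c p.1 p.2 / v p.1 p.2 * vx p.1 p.2) by ring]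
  have hneg := riccati_neg (u := u p.1 p.2) (r := r p.1 p.2) (c := c p.1 p.2) hγ1 hγ2 hD v0
    (by rw [hα]; positivity) (hβ.trans_eq hα.symm) (by rw [hα]; exact hcond)
  filter_upwards [tR.eventually_lt_const
    (mul_neg_of_pos_of_neg (Real.rpow_pos_of_pos v0 _) hneg)] with z hz _ _ using hz

theorem eventually_lt_left_of_hasDerivAt_pos {f : ℝ → ℝ} {f' t : ℝ} (hf : HasDerivAt f f' t)
    (hf' : 0 < f') : ∀ᶠ s in 𝓝[<] t, f s < f t := by
  have h := (hasDerivAt_iff_tendsto_slope.1 hf).mono_left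
    (nhdsWithin_mono t (fun s (hs : s < t) => hs.ne))
  filter_upwards [h.eventually_const_lt hf', self_mem_nhdsWithin] with s hs hst
  rw [slope_def_field] at hs
  have hst : s - t < 0 := sub_neg.2 hst
  by_contra! hle
  exact absurd hs (div_nonpos_of_nonneg_of_nonpos (sub_nonneg.2 hle) hst.le).not_gt

/-- First-touching-time argument on a compact space-time region. -/
theorem barrier {R : Set (ℝ × ℝ)} (hR : IsCompact R) {F G : ℝ → ℝ → ℝ} {n : ℝ}
    (hF : ContinuousOn (fun p : ℝ × ℝ => F p.1 p.2) R)
    (hG : ContinuousOn (fun p : ℝ × ℝ => G p.1 p.2) R)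
    (hR0 : ∀ p ∈ R, 0 ≤ p.2) (h0 : ∀ p ∈ R, p.2 = 0 → F p.1 p.2 < n ∧ G p.1 p.2 < n)
    (hF' : ∀ p ∈ R, 0 < p.2 → ∃ (X : ℝ → ℝ) (F' : ℝ), X p.2 = p.1 ∧ ContinuousAt X p.2 ∧
      (∀ᶠ s in 𝓝[<] p.2, (X s, s) ∈ R) ∧ HasDerivAt (fun s => F (X s) s) F' p.2 ∧
      (F p.1 p.2 = n → G p.1 p.2 ≤ n → F' < 0))
    (hG' : ∀ p ∈ R, 0 < p.2 → ∃ (X : ℝ → ℝ) (G' : ℝ), X p.2 = p.1 ∧ ContinuousAt X p.2 ∧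
      (∀ᶠ s in 𝓝[<] p.2, (X s, s) ∈ R) ∧ HasDerivAt (fun s => G (X s) s) G' p.2 ∧
      (G p.1 p.2 = n → F p.1 p.2 ≤ n → G' < 0)) :
    ∀ p ∈ R, F p.1 p.2 < n ∧ G p.1 p.2 < n := by
  by_contra! hcon
  have hM : ContinuousOn (fun p : ℝ × ℝ => max (F p.1 p.2) (G p.1 p.2)) R := ContinuousOn.sup hF hG
  have hB : IsCompact (R ∩ (fun p : ℝ × ℝ => max (F p.1 p.2) (G p.1 p.2)) ⁻¹' Ici n) :=
    hR.of_isClosed_subset (hM.preimage_isClosed_of_isClosed hR.isClosed isClosed_Ici)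
      inter_subset_left
  obtain ⟨q, hqR, hq⟩ := hcon
  obtain ⟨p, ⟨hpR, hpn⟩, hmin⟩ := hB.exists_isMinOn
    ⟨q, hqR, show n ≤ max _ _ from by
      rw [le_max_iff]
      exact (lt_or_ge (F q.1 q.2) n).symm.imp_right hq⟩ continuous_snd.continuousOn
  have hpn : n ≤ max (F p.1 p.2) (G p.1 p.2) := hpn
  have hp0 : 0 < p.2 := by
    refine (hR0 p hpR).lt_of_ne fun h => ?_
    exact absurd hpn (max_lt (h0 p hpR h.symm).1 (h0 p hpR h.symm).2).not_ge
  have hbefore : ∀ X : ℝ → ℝ, (∀ᶠ s in 𝓝[<] p.2, (X s, s) ∈ R) →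
      ∀ᶠ s in 𝓝[<] p.2, (X s, s) ∈ R ∧ F (X s) s < n ∧ G (X s) s < n := by
    intro X hX
    filter_upwards [hX, self_mem_nhdsWithin] with s hs hsp
    have : ¬ n ≤ max (F (X s) s) (G (X s) s) := fun h =>
      absurd (show p.2 ≤ s from hmin ⟨hs, h⟩) (not_le.2 hsp)
    exact ⟨hs, max_lt_iff.1 (not_le.1 this)⟩
  have hle : F p.1 p.2 ≤ n ∧ G p.1 p.2 ≤ n := by
    obtain ⟨X, F', hX, hXc, hXR, -, -⟩ := hF' p hpR hp0
    have ht : Tendsto (fun s => (X s, s)) (𝓝[<] p.2) (𝓝[R] p) := by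
      refine tendsto_nhdsWithin_iff.2 ⟨?_, hXR⟩
      have : Tendsto (fun s => (X s, s)) (𝓝 p.2) (𝓝 (X p.2, p.2)) :=
        (hXc.prodMk continuousAt_id).tendsto
      rw [hX] at this
      exact this.mono_left nhdsWithin_le_nhds
    exact ⟨le_of_tendsto ((hF p hpR).tendsto.comp ht)
        ((hbefore X hXR).mono fun s hs => hs.2.1.le),
      le_of_tendsto ((hG p hpR).tendsto.comp ht) ((hbefore X hXR).mono fun s hs => hs.2.2.le)⟩
  have habs : ∀ (H : ℝ → ℝ) (H' : ℝ), HasDerivAt H H' p.2 → H' < 0 → H p.2 = n →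
      (∀ᶠ s in 𝓝[<] p.2, H s < n) → False := by
    intro H H' hH hH' hHn hlt
    obtain ⟨s, hs1, hs2⟩ :=
      ((eventually_lt_left_of_hasDerivAt_pos hH.neg (neg_pos.2 hH')).and hlt).exists
    simp only [Pi.neg_apply] at hs1
    linarith
  rcases le_max_iff.1 hpn with h | h
  · obtain ⟨X, F', hX, -, hXR, hd, hneg⟩ := hF' p hpR hp0
    have hFn := le_antisymm hle.1 h
    exact habs _ _ hd (hneg hFn hle.2) (by simpa only [hX] using hFn)
      ((hbefore X hXR).mono fun s hs => hs.2.1)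
  · obtain ⟨X, G', hX, -, hXR, hd, hneg⟩ := hG' p hpR hp0
    have hGn := le_antisymm hle.2 h
    exact habs _ _ hd (hneg hGn hle.1) (by simpa only [hX] using hGn)
      ((hbefore X hXR).mono fun s hs => hs.2.2)

theorem eventually_forall_of_isCompact {ι : Type*} {l : Filter ι} {R S : Set (ℝ × ℝ)}
    (hR : IsCompact R) (hRS : R ⊆ S) {P : ι → ℝ × ℝ → Prop}
    (h : ∀ p ∈ R, ∀ᶠ z : ι × ℝ × ℝ in l ×ˢ 𝓝[S] p, P z.1 z.2) :
    ∀ᶠ i in l, ∀ p ∈ R, P i p := by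
  refine hR.induction_on (p := fun s => ∀ᶠ i in l, ∀ p ∈ s, P i p) (by simp)
    (fun s t hst ht => ht.mono fun i hi p hp => hi p (hst hp))
    (fun s t hs ht => ?_) (fun p hp => ?_)
  · filter_upwards [hs, ht] with i hi hi' p hp using hp.elim (hi p) (hi' p)
  · obtain ⟨Q, hQ, Q', hQ', hQQ⟩ := eventually_prod_iff.1 (h p hp)
    exact ⟨{q | Q' q}, nhdsWithin_mono p hRS hQ', hQ.mono fun i hi q hq => hQQ hi hq⟩

/-- The points of the domain of dependence to the right of `xp` up to time `t₁`, at which the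
particle position is at most `R₁`. -/
def depRegion (r : ℝ → ℝ → ℝ) (xp : ℝ → ℝ) (t₁ R₁ : ℝ) : Set (ℝ × ℝ) :=
  {p | p.2 ∈ Icc 0 t₁ ∧ xp p.2 ≤ p.1 ∧ r p.1 p.2 ≤ R₁}

theorem EulerStrip.isCompact_depRegion {γ D T δ t₁ R₁ : ℝ} {v u r c vx ux : ℝ → ℝ → ℝ}
    (E : EulerStrip γ D T v u r c vx ux) (hD : 0 < D) (hδ : 0 < δ)
    (hdens : ∀ x t, 0 < x → t ∈ Ico 0 T → δ ≤ r x t ^ D * v x t) (hR₁ : 0 < R₁)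
    {xp : ℝ → ℝ} (ht₁ : 0 ≤ t₁) (ht₁T : t₁ < T) (hxp : ContinuousOn xp (Icc 0 t₁))
    (hxp0 : ∀ s ∈ Icc 0 t₁, 0 < xp s) : IsCompact (depRegion r xp t₁ R₁) := by
  obtain ⟨a, ha, hlo⟩ := isCompact_Icc.exists_isMinOn ⟨0, left_mem_Icc.2 ht₁⟩ hxp
  obtain ⟨b, hb, hhi⟩ := isCompact_Icc.exists_isMaxOn ⟨0, left_mem_Icc.2 ht₁⟩ hxp
  have hRD := Real.rpow_pos_of_pos hR₁ D
  have hsub : Icc (xp a) (xp b + R₁ * R₁ ^ D / δ) ×ˢ Icc 0 t₁ ⊆ strip T := fun p hp =>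
    ⟨(hxp0 a ha).trans_le hp.1.1, hp.2.1, hp.2.2.trans_lt ht₁T⟩
  have hslope : ∀ y z s, s ∈ Icc 0 t₁ → 0 < y → y < z →
      ∃ ξ ∈ Ioo y z, r z s - r y s = v ξ s * (z - y) := by
    intro y z s hs hy hyz
    have hsT : s ∈ Ico 0 T := ⟨hs.1, hs.2.trans_lt ht₁T⟩
    obtain ⟨ξ, hξ, hξ'⟩ := exists_hasDerivAt_eq_slope (fun x => r x s) (fun x => v x s) hyz
      (fun x hx => (E.hr.hasx x s (hy.trans_le hx.1) hsT).continuousAt.continuousWithinAt)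
      (fun x hx => E.hr.hasx x s (hy.trans hx.1) hsT)
    exact ⟨ξ, hξ, by rw [hξ', div_mul_cancel₀ _ (sub_pos.2 hyz).ne']⟩
  have hEq : depRegion r xp t₁ R₁ = Icc (xp a) (xp b + R₁ * R₁ ^ D / δ) ×ˢ Icc 0 t₁ ∩
      (fun p : ℝ × ℝ => (p.1 - xp p.2, r p.1 p.2)) ⁻¹' (Ici 0 ×ˢ Iic R₁) := by
    ext ⟨x, s⟩
    constructor
    · rintro ⟨hs, hx, hr⟩
      simp only at hs hx hr
      have hsT : s ∈ Ico 0 T := ⟨hs.1, hs.2.trans_lt ht₁T⟩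
      refine ⟨⟨⟨(hlo hs : xp a ≤ xp s).trans hx, ?_⟩, hs⟩, sub_nonneg.2 hx, hr⟩
      have hsb : xp s ≤ xp b := hhi hs
      rcases hx.eq_or_lt with hx | hx
      · rw [← hx]
        have : 0 ≤ R₁ * R₁ ^ D / δ := by positivity
        simp only; linarith
      obtain ⟨ξ, hξ, hξ'⟩ := hslope (xp s) x s hs (hxp0 s hs) hx
      have hξ0 := (hxp0 s hs).trans hξ.1
      obtain ⟨ζ, hζ, hζ'⟩ := hslope ξ x s hs hξ0 hξ.2
      have hvζ := E.vpos ζ s (hξ0.trans hζ.1) hsT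
      have hrξ : r ξ s ≤ R₁ := by
        have := mul_pos hvζ (sub_pos.2 hξ.2)
        linarith
      have hvξ := E.vpos ξ s hξ0 hsT
      have hv : δ ≤ R₁ ^ D * v ξ s := (hdens ξ s hξ0 hsT).trans
        (mul_le_mul_of_nonneg_right
          (Real.rpow_le_rpow (E.rpos ξ s hξ0 hsT).le hrξ hD.le) hvξ.le)
      have hrx := E.rpos (xp s) s (hxp0 s hs) hsT
      have h1 : v ξ s * (x - xp s) ≤ R₁ := by linarith
      have h2 : x - xp s ≤ R₁ * R₁ ^ D / δ := by
        rw [le_div_iff₀ hδ]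
        have := mul_le_mul_of_nonneg_left hv (sub_pos.2 hx).le
        have := mul_le_mul_of_nonneg_left h1 hRD.le
        linarith
      simp only; linarith
    · rintro ⟨⟨-, hs⟩, hx, hr⟩
      exact ⟨hs, sub_nonneg.1 hx, hr⟩
  rw [hEq]
  refine (isCompact_Icc.prod isCompact_Icc).of_isClosed_subset
    (ContinuousOn.preimage_isClosed_of_isClosed ?_ (isClosed_Icc.prod isClosed_Icc)
      (isClosed_Ici.prod isClosed_Iic)) inter_subset_left
  exact (continuousOn_fst.sub (hxp.comp continuousOn_snd fun p hp => hp.2)).prodMk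
    (E.hr.cont.mono hsub)

theorem EulerStrip.eventually_mem_depRegion {γ D T t₁ R₁ : ℝ} {v u r c vx ux : ℝ → ℝ → ℝ}
    (E : EulerStrip γ D T v u r c vx ux) (ht₁T : t₁ < T) {xp : ℝ → ℝ} {p : ℝ × ℝ}
    (hp : p ∈ depRegion r xp t₁ R₁) (hp1 : 0 < p.1) (hp2 : 0 < p.2) {X : ℝ → ℝ} {X' : ℝ}
    (hX : X p.2 = p.1) (hX' : HasDerivAt X X' p.2)
    (hu : 0 < u p.1 p.2 + X' * v p.1 p.2) (hxp : ∀ᶠ s in 𝓝[<] p.2, xp s ≤ X s) :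
    ∀ᶠ s in 𝓝[<] p.2, (X s, s) ∈ depRegion r xp t₁ R₁ := by
  have hr := eventually_lt_left_of_hasDerivAt_pos
    (E.hr.chain p.1 p.2 X X' hp1 ⟨hp2, hp.1.2.trans_lt ht₁T⟩ hX hX') hu
  filter_upwards [hr, hxp, Ioo_mem_nhdsLT hp2] with s h1 h2 h3
  rw [hX] at h1
  exact ⟨⟨h3.1.le, h3.2.le.trans hp.1.2⟩, h2, h1.le.trans hp.2.2⟩

theorem EulerStrip.weighted_gradient_lt {γ D T δ N n₀ t₁ : ℝ} {v u r c vx ux : ℝ → ℝ → ℝ}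
    (E : EulerStrip γ D T v u r c vx ux) (hγ1 : 5 / 3 < γ) (hγ2 : γ < 3) (hD : 0 < D)
    (hδ : 0 < δ) (hdens : ∀ x t, 0 < x → t ∈ Ico 0 T → δ ≤ r x t ^ D * v x t)
    (hc : ∀ x t, 0 < x → t ∈ Ico 0 T → 0 < c x t)
    (hcu : ∀ x t, 0 < x → t ∈ Ico 0 T → 2 / (γ - 1) * c x t ≤ u x t)
    {xp : ℝ → ℝ} (ht₁ : 0 ≤ t₁) (ht₁T : t₁ < T)
    (hxp : ∀ s ∈ Icc 0 t₁, HasDerivAt xp (c (xp s) s / v (xp s) s) s)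
    (hxp0 : ∀ s ∈ Icc 0 t₁, 0 < xp s) (hn₀ : 0 ≤ n₀) (hn₀N : n₀ < N)
    (hthr : ∀ s ∈ Icc 0 t₁, ∀ x, xp s ≤ x →
      D * c x s / r x s ≤ n₀ * v x s ^ ((3 - γ) / 2) / v x s)
    (hinit : ∀ x, xp 0 ≤ x →
      v x 0 ^ (-((3 - γ) / 2)) * (ux x 0 - c x 0 / v x 0 * vx x 0) < N ∧
      v x 0 ^ (-((3 - γ) / 2)) * (ux x 0 + c x 0 / v x 0 * vx x 0) < N)
    {x₁ : ℝ} (hx₁ : xp t₁ ≤ x₁) :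
    v x₁ t₁ ^ (-((3 - γ) / 2)) * (ux x₁ t₁ - c x₁ t₁ / v x₁ t₁ * vx x₁ t₁) < N ∧
    v x₁ t₁ ^ (-((3 - γ) / 2)) * (ux x₁ t₁ + c x₁ t₁ / v x₁ t₁ * vx x₁ t₁) < N := by
  have hγ : 1 < γ := by linarith
  have ht₁m : t₁ ∈ Icc 0 t₁ := right_mem_Icc.2 ht₁
  have ht₁S : t₁ ∈ Ico 0 T := ⟨ht₁, ht₁T⟩
  have hx₁0 : 0 < x₁ := (hxp0 t₁ ht₁m).trans_le hx₁
  set R := depRegion r xp t₁ (r x₁ t₁) with hRdef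
  have hRc : IsCompact R := E.isCompact_depRegion hD hδ hdens (E.rpos x₁ t₁ hx₁0 ht₁S) ht₁ ht₁T
    (fun s hs => (hxp s hs).continuousAt.continuousWithinAt) hxp0
  have hRS : R ⊆ strip T := fun p hp =>
    ⟨(hxp0 p.2 hp.1).trans_le hp.2.1, hp.1.1, hp.1.2.trans_lt ht₁T⟩
  have h1R : (x₁, t₁) ∈ R := ⟨ht₁m, hx₁, le_rfl⟩
  have hvx : ∀ q ∈ strip T, v q.1 q.2 ≠ 0 := fun q hq => (E.vpos _ _ hq.1 hq.2).ne'
  have hcα : ContinuousOn (fun p : ℝ × ℝ => v p.1 p.2 ^ (-((3 - γ) / 2)) *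
      (ux p.1 p.2 - c p.1 p.2 / v p.1 p.2 * vx p.1 p.2)) (strip T) :=
    (E.hv.cont.rpow_const fun q hq => Or.inl (hvx q hq)).mul
      (E.hu.contx.sub ((E.hc.cont.div E.hv.cont hvx).mul E.hv.contx))
  have hcβ : ContinuousOn (fun p : ℝ × ℝ => v p.1 p.2 ^ (-((3 - γ) / 2)) *
      (ux p.1 p.2 + c p.1 p.2 / v p.1 p.2 * vx p.1 p.2)) (strip T) :=
    (E.hv.cont.rpow_const fun q hq => Or.inl (hvx q hq)).mul
      (E.hu.contx.add ((E.hc.cont.div E.hv.cont hvx).mul E.hv.contx))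
  have hneg_eq : ∀ x t, ux x t - -c x t / v x t * vx x t = ux x t + c x t / v x t * vx x t :=
    fun x t => by ring
  have hne0 : ∀ {ι : Type} (l : Filter ι) (p : ℝ × ℝ), p.2 ≠ 0 →
      ∀ᶠ z : ι × ℝ × ℝ in l ×ˢ 𝓝[strip T] p, z.2.2 ≠ 0 := fun l p hp =>
    (((continuous_snd.tendsto p).mono_left nhdsWithin_le_nhds).comp tendsto_snd).eventually_ne hp
  obtain ⟨n, hn0, hnN : n < N, hninit⟩ : ∃ n, n₀ < n ∧ n < N ∧ ∀ p ∈ R, p.2 = 0 →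
      v p.1 p.2 ^ (-((3 - γ) / 2)) * (ux p.1 p.2 - c p.1 p.2 / v p.1 p.2 * vx p.1 p.2) < n ∧
      v p.1 p.2 ^ (-((3 - γ) / 2)) * (ux p.1 p.2 + c p.1 p.2 / v p.1 p.2 * vx p.1 p.2) < n := by
    have h1 := eventually_forall_of_isCompact (l := 𝓝[<] N) hRc hRS
      (P := fun n p => p.2 = 0 →
        v p.1 p.2 ^ (-((3 - γ) / 2)) * (ux p.1 p.2 - c p.1 p.2 / v p.1 p.2 * vx p.1 p.2) < n ∧
        v p.1 p.2 ^ (-((3 - γ) / 2)) * (ux p.1 p.2 + c p.1 p.2 / v p.1 p.2 * vx p.1 p.2) < n) ?_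
    · have h2 : ∀ᶠ n in 𝓝[<] N, n ∈ Ioo n₀ N := Ioo_mem_nhdsLT hn₀N
      obtain ⟨n, ⟨hn1, hn2⟩, hn3⟩ := (h2.and h1).exists
      exact ⟨n, hn1, hn2, hn3⟩
    · intro p hp
      by_cases hp0 : p.2 = 0
      · have hi := hinit p.1 (hp0 ▸ hp.2.1)
        rw [← hp0] at hi
        have tn : Tendsto (fun z : ℝ × ℝ × ℝ => z.1) (𝓝[<] N ×ˢ 𝓝[strip T] p) (𝓝 N) :=
          tendsto_fst.mono_right nhdsWithin_le_nhds
        filter_upwards [((hcα p (hRS hp)).tendsto.comp tendsto_snd).eventually_lt tn hi.1,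
          ((hcβ p (hRS hp)).tendsto.comp tendsto_snd).eventually_lt tn hi.2] with z h1 h2 _
          using ⟨h1, h2⟩
      · filter_upwards [hne0 _ p hp0] with z hz h using absurd h hz
  have hn : 0 < n := hn₀.trans_lt hn0
  have hgood : ∀ᶠ h in 𝓝[>] (0 : ℝ), ∀ p ∈ R,
      (weightedQuot γ D v u r c h p.1 p.2 = n →
        weightedQuot γ D v u r (fun x t => -c x t) h p.1 p.2 ≤ n →
        weightedQuotRate γ D v u r c vx ux h p.1 p.2 < 0) ∧
      (weightedQuot γ D v u r (fun x t => -c x t) h p.1 p.2 = n →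
        weightedQuot γ D v u r c h p.1 p.2 ≤ n →
        weightedQuotRate γ D v u r (fun x t => -c x t) vx ux h p.1 p.2 < 0) ∧
      (p.2 = 0 → weightedQuot γ D v u r c h p.1 p.2 < n ∧
        weightedQuot γ D v u r (fun x t => -c x t) h p.1 p.2 < n) := by
    refine eventually_forall_of_isCompact hRc hRS
      (P := fun h p => (weightedQuot γ D v u r c h p.1 p.2 = n →
        weightedQuot γ D v u r (fun x t => -c x t) h p.1 p.2 ≤ n →
        weightedQuotRate γ D v u r c vx ux h p.1 p.2 < 0) ∧
      (weightedQuot γ D v u r (fun x t => -c x t) h p.1 p.2 = n →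
        weightedQuot γ D v u r c h p.1 p.2 ≤ n →
        weightedQuotRate γ D v u r (fun x t => -c x t) vx ux h p.1 p.2 < 0) ∧
      (p.2 = 0 → weightedQuot γ D v u r c h p.1 p.2 < n ∧
        weightedQuot γ D v u r (fun x t => -c x t) h p.1 p.2 < n)) fun p hp => ?_
    have hpS := hRS hp
    have v0 := E.vpos p.1 p.2 hpS.1 hpS.2
    have r0 := E.rpos p.1 p.2 hpS.1 hpS.2
    have c0 := hc p.1 p.2 hpS.1 hpS.2
    have hcu0 := hcu p.1 p.2 hpS.1 hpS.2
    have hthr0 : D * c p.1 p.2 / r p.1 p.2 ≤ n * v p.1 p.2 ^ ((3 - γ) / 2) / v p.1 p.2 :=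
      (hthr p.2 hp.1 p.1 hp.2.1).trans (by gcongr)
    have u0 : 0 < u p.1 p.2 := lt_of_lt_of_le
      (mul_pos (div_pos two_pos (by linarith)) c0) hcu0
    have w0 : 0 ≤ n * v p.1 p.2 ^ ((3 - γ) / 2) / v p.1 p.2 := by positivity
    have h35 : 0 ≤ (3 * γ - 5) / 4 := by linarith
    have hcond1 : 0 ≤ (3 * γ - 5) / 4 * (n * v p.1 p.2 ^ ((3 - γ) / 2) / v p.1 p.2)
        + D * (γ - 1) / 4 * ((u p.1 p.2 - 3 * c p.1 p.2) / r p.1 p.2) := by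
      have h1 := mul_le_mul_of_nonneg_left hthr0 h35
      have h2 : 2 * c p.1 p.2 ≤ (γ - 1) * u p.1 p.2 := by
        have := mul_le_mul_of_nonneg_left hcu0 (sub_pos.2 hγ).le
        rwa [← mul_assoc, mul_div_cancel₀ _ (sub_pos.2 hγ).ne'] at this
      have h3 : 0 ≤ D / (4 * r p.1 p.2) * ((γ - 1) * u p.1 p.2 - 2 * c p.1 p.2) :=
        mul_nonneg (by positivity) (sub_nonneg.2 h2)
      have h4 : D * (γ - 1) / 4 * ((u p.1 p.2 - 3 * c p.1 p.2) / r p.1 p.2) =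
          D / (4 * r p.1 p.2) * ((γ - 1) * u p.1 p.2 - 2 * c p.1 p.2)
            - (3 * γ - 5) / 4 * (D * c p.1 p.2 / r p.1 p.2) := by
        field_simp
        ring
      linarith
    have hcond2 : 0 ≤ (3 * γ - 5) / 4 * (n * v p.1 p.2 ^ ((3 - γ) / 2) / v p.1 p.2)
        + D * (γ - 1) / 4 * ((u p.1 p.2 - 3 * -c p.1 p.2) / r p.1 p.2) := by
      have : 0 < γ - 1 := sub_pos.2 hγ
      have : 0 ≤ u p.1 p.2 - 3 * -c p.1 p.2 := by linarith
      positivity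
    have e1 := E.eventually_weightedQuotRate_neg hγ hγ2 hD hn hpS hcond1
    have e2 := E.neg.eventually_weightedQuotRate_neg hγ hγ2 hD hn hpS hcond2
    simp only [neg_neg] at e2
    refine e1.and (e2.and ?_)
    by_cases hp0 : p.2 = 0
    · have hi := hninit p hp hp0
      rw [← hneg_eq] at hi
      filter_upwards [(E.tendsto_weightedQuot hγ hpS).eventually_lt_const hi.1,
        (E.neg.tendsto_weightedQuot hγ hpS).eventually_lt_const hi.2] with z h1 h2 _
        using ⟨h1, h2⟩
    · filter_upwards [hne0 _ p hp0] with z hz h using absurd h hz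
  have hlt : ∀ᶠ h in 𝓝[>] (0 : ℝ), weightedQuot γ D v u r c h x₁ t₁ < n ∧
      weightedQuot γ D v u r (fun x t => -c x t) h x₁ t₁ < n := by
    filter_upwards [hgood, self_mem_nhdsWithin] with h hgood hh
    have hh : 0 < h := hh
    have hcont : ∀ {c : ℝ → ℝ → ℝ}, EulerStrip γ D T v u r c vx ux →
        ContinuousOn (fun p : ℝ × ℝ => weightedQuot γ D v u r c h p.1 p.2) R := by
      intro c E
      have hw : ContinuousOn (fun p : ℝ × ℝ => u p.1 p.2 + 2 / (γ - 1) * c p.1 p.2) (strip T) :=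
        E.hu.cont.add (continuousOn_const.mul E.hc.cont)
      have hsh : ContinuousOn (fun p : ℝ × ℝ => (p.1 + h, p.2)) (strip T) := by fun_prop
      refine ContinuousOn.mono ?_ hRS
      exact (E.hv.cont.rpow_const fun q hq => Or.inl (hvx q hq)).mul
        ((((hw.comp hsh fun q hq => ⟨add_pos hq.1 hh, hq.2⟩).sub hw).div_const h).add
          (((continuousOn_const.mul E.hc.cont).mul E.hv.cont).div E.hr.cont
            fun q hq => (E.rpos _ _ hq.1 hq.2).ne'))
    have hspeed : ∀ x t, 0 < x → t ∈ Ico 0 T → c x t < u x t ∧ 0 < c x t / v x t := by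
      intro x t hx ht
      have c0 := hc x t hx ht
      refine ⟨lt_of_lt_of_le ?_ (hcu x t hx ht), div_pos c0 (E.vpos x t hx ht)⟩
      have : 1 < 2 / (γ - 1) := by rw [lt_div_iff₀ (by linarith)]; linarith
      nlinarith
    refine barrier hRc (hcont E) (hcont E.neg) (fun p hp => hp.1.1)
      (fun p hp => (hgood p hp).2.2) (fun p hp hp0 => ?_) (fun p hp hp0 => ?_) (x₁, t₁) h1R
    · have hpS := hRS hp
      have hpt : p.2 ∈ Ioo 0 T := ⟨hp0, hpS.2.2⟩
      obtain ⟨X, hX, hX', hXxp⟩ : ∃ X : ℝ → ℝ, X p.2 = p.1 ∧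
          HasDerivAt X (c p.1 p.2 / v p.1 p.2) p.2 ∧ ∀ᶠ s in 𝓝[<] p.2, xp s ≤ X s := by
        rcases hp.2.1.eq_or_lt with heq | hlt
        · exact ⟨xp, heq, by simpa only [heq] using hxp p.2 hp.1, Eventually.of_forall fun _ => le_rfl⟩
        · have hd : HasDerivAt (fun s => p.1 + c p.1 p.2 / v p.1 p.2 * (s - p.2))
              (c p.1 p.2 / v p.1 p.2) p.2 := by
            simpa using (((hasDerivAt_id p.2).sub_const p.2).const_mul
              (c p.1 p.2 / v p.1 p.2)).const_add p.1
          refine ⟨_, by simp, hd, ?_⟩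
          have := (hxp p.2 hp.1).continuousAt.tendsto.eventually_lt hd.continuousAt.tendsto
            (by simpa using hlt)
          exact (this.filter_mono nhdsWithin_le_nhds).mono fun s hs => hs.le
      refine ⟨X, _, hX, hX'.continuousAt, ?_, E.hasDerivAt_along hγ hh hpS.1 hpt hX hX',
        (hgood p hp).1⟩
      refine E.eventually_mem_depRegion ht₁T hp hpS.1 hp0 hX hX' ?_ hXxp
      rw [div_mul_cancel₀ _ (hvx p hpS)]
      have := hc p.1 p.2 hpS.1 hpS.2
      linarith [(hspeed p.1 p.2 hpS.1 hpS.2).1]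
    · have hpS := hRS hp
      have hpt : p.2 ∈ Ioo 0 T := ⟨hp0, hpS.2.2⟩
      have hd : HasDerivAt (fun s => p.1 + -c p.1 p.2 / v p.1 p.2 * (s - p.2))
          (-c p.1 p.2 / v p.1 p.2) p.2 := by
        simpa using (((hasDerivAt_id p.2).sub_const p.2).const_mul
          (-c p.1 p.2 / v p.1 p.2)).const_add p.1
      have hX : (fun s => p.1 + -c p.1 p.2 / v p.1 p.2 * (s - p.2)) p.2 = p.1 := by simp
      refine ⟨_, _, hX, hd.continuousAt, ?_, E.neg.hasDerivAt_along hγ hh hpS.1 hpt hX hd,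
        (hgood p hp).2.1⟩
      refine E.eventually_mem_depRegion ht₁T hp hpS.1 hp0 hX hd ?_ ?_
      · rw [div_mul_cancel₀ _ (hvx p hpS)]
        linarith [(hspeed p.1 p.2 hpS.1 hpS.2).1]
      · have h1 := (hspeed _ _ (hxp0 p.2 hp.1) hpS.2).2
        have h2 := (hspeed p.1 p.2 hpS.1 hpS.2).2
        have hpos : 0 < c (xp p.2) p.2 / v (xp p.2) p.2 - -c p.1 p.2 / v p.1 p.2 := by
          rw [neg_div]; linarith
        filter_upwards [eventually_lt_left_of_hasDerivAt_pos ((hxp p.2 hp.1).sub hd) hpos]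
          with s hs
        simp only [Pi.sub_apply, sub_self, mul_zero, add_zero] at hs
        linarith [hp.2.1]
  have hfix : Tendsto (fun h : ℝ => (h, (x₁, t₁))) (𝓝[>] 0) (𝓝[>] 0 ×ˢ 𝓝[strip T] (x₁, t₁)) :=
    tendsto_id.prodMk (tendsto_const_pure.mono_right (pure_le_nhdsWithin (hRS h1R)))
  have hA := (E.tendsto_weightedQuot hγ (hRS h1R)).comp hfix
  have hB := (E.neg.tendsto_weightedQuot hγ (hRS h1R)).comp hfix
  rw [hneg_eq] at hB
  exact ⟨(le_of_tendsto hA (hlt.mono fun h hh => hh.1.le)).trans_lt hnN,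
    (le_of_tendsto hB (hlt.mono fun h hh => hh.2.le)).trans_lt hnN⟩

theorem StripC1.congr {T : ℝ} {f fx ft fx' ft' : ℝ → ℝ → ℝ} (hf : StripC1 T f fx ft)
    (hx : ∀ x t, 0 < x → t ∈ Ico 0 T → fx' x t = fx x t)
    (ht : ∀ x t, 0 < x → t ∈ Ico 0 T → ft' x t = ft x t) : StripC1 T f fx' ft' where
  cont := hf.cont
  contx := hf.contx.congr fun p hp => hx p.1 p.2 hp.1 hp.2
  hasx x t h0 hT := hx x t h0 hT ▸ hf.hasx x t h0 hT
  chain x t X X' h0 hT hX hX' := by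
    rw [hx x t h0 (Ioo_subset_Ico_self hT), ht x t h0 (Ioo_subset_Ico_self hT)]
    exact hf.chain x t X X' h0 hT hX hX'

theorem HasDerivAt.const_mul_rpow_mul_rpow {R V : ℝ → ℝ} {R' V' t κ D q : ℝ}
    (hR : HasDerivAt R R' t) (hV : HasDerivAt V V' t) (hR0 : 0 < R t) (hV0 : 0 < V t) :
    HasDerivAt (fun s => κ * (R s ^ D * V s) ^ q)
      (κ * (R t ^ D * V t) ^ q * q * (D * R' / R t + V' / V t)) t := by
  have hB : 0 < R t ^ D * V t := mul_pos (Real.rpow_pos_of_pos hR0 D) hV0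
  have hRD := (Real.rpow_pos_of_pos hR0 D).ne'
  refine ((((hR.rpow_const (p := D) (Or.inl hR0.ne')).mul hV).rpow_const (p := q)
    (Or.inl hB.ne')).const_mul κ).congr_deriv ?_
  simp only [Pi.mul_apply]
  rw [Real.rpow_sub_one hB.ne', Real.rpow_sub_one hR0.ne']
  field_simp

/-- The Eulerian sound speed `√(Kγ) ρ^{(γ-1)/2}` in Lagrangian variables. -/
def soundSpeed (K γ : ℝ) (d : ℕ) (v r : ℝ → ℝ → ℝ) (x t : ℝ) : ℝ :=
  Real.sqrt (K * γ) * (r x t ^ ((d : ℝ) - 1) * v x t) ^ (-(γ - 1) / 2)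

theorem etaF_eq {K γ : ℝ} {d : ℕ} {v r : ℝ → ℝ → ℝ} {x t : ℝ} (hv : 0 < v x t)
    (hr : 0 < r x t) :
    etaF K γ d v r x t = 2 * Real.sqrt (K * γ) / (γ - 1) * v x t ^ (-(γ - 1) / 2) := by
  have hA : 0 < Afun d (r x t) := Real.rpow_pos_of_pos hr _
  have hAe := (Real.rpow_pos_of_pos hA ((γ - 1) / 2)).ne'
  rw [etaF, rhoF, Real.inv_rpow (by positivity), Real.mul_rpow hA.le hv.le, neg_div,
    Real.rpow_neg hv.le]
  field_simp

theorem Afun_rpow_mul_etaF {K γ : ℝ} {d : ℕ} {v r : ℝ → ℝ → ℝ} {x t : ℝ} (hv : 0 < v x t)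
    (hr : 0 < r x t) :
    Afun d (r x t) ^ (-(γ - 1) / 2) * etaF K γ d v r x t =
      2 / (γ - 1) * soundSpeed K γ d v r x t := by
  have hA : 0 < r x t ^ ((d : ℝ) - 1) := Real.rpow_pos_of_pos hr _
  rw [etaF_eq hv hr, soundSpeed, Real.mul_rpow hA.le hv.le, Afun]
  ring

theorem deriv_etaF {K γ : ℝ} {d : ℕ} {v r : ℝ → ℝ → ℝ} {x t vx : ℝ} (hx : 0 < x)
    (hv : ∀ y, 0 < y → 0 < v y t) (hr : ∀ y, 0 < y → 0 < r y t)
    (hvx : HasDerivAt (fun s => v s t) vx x) :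
    deriv (fun s => etaF K γ d v r s t) x =
      etaF K γ d v r x t * (-(γ - 1) / 2) * vx / v x t := by
  have h1 : (fun s => etaF K γ d v r s t) =ᶠ[𝓝 x]
      fun s => 2 * Real.sqrt (K * γ) / (γ - 1) * v s t ^ (-(γ - 1) / 2) := by
    filter_upwards [Ioi_mem_nhds hx] with s hs using etaF_eq (hv s hs) (hr s hs)
  have h2 := (hvx.rpow_const (p := -(γ - 1) / 2) (Or.inl (hv x hx).ne')).const_mul
    (2 * Real.sqrt (K * γ) / (γ - 1))
  rw [h1.deriv_eq, h2.deriv, Real.rpow_sub_one (hv x hx).ne', etaF_eq (hv x hx) (hr x hx)]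
  ring

theorem Afun_rpow_mul_deriv_etaF {K γ : ℝ} {d : ℕ} {v r : ℝ → ℝ → ℝ} {x t vx : ℝ} (hγ : 1 < γ)
    (hx : 0 < x) (hv : ∀ y, 0 < y → 0 < v y t) (hr : ∀ y, 0 < y → 0 < r y t)
    (hvx : HasDerivAt (fun s => v s t) vx x) :
    Afun d (r x t) ^ (-(γ - 1) / 2) * deriv (fun s => etaF K γ d v r s t) x =
      -(soundSpeed K γ d v r x t / v x t * vx) := by
  have hγ' : γ - 1 ≠ 0 := by linarith
  rw [deriv_etaF hx hv hr hvx, show Afun d (r x t) ^ (-(γ - 1) / 2) *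
    (etaF K γ d v r x t * (-(γ - 1) / 2) * vx / v x t) =
    (Afun d (r x t) ^ (-(γ - 1) / 2) * etaF K γ d v r x t) * (-(γ - 1) / 2) * vx / v x t by ring,
    Afun_rpow_mul_etaF (hv x hx) (hr x hx)]
  field_simp

theorem etaF_rpow {K γ : ℝ} {d : ℕ} {v r : ℝ → ℝ → ℝ} {x t : ℝ} (hγ : 1 < γ) (hv : 0 < v x t)
    (hr : 0 < r x t) (q : ℝ) :
    etaF K γ d v r x t ^ (q / (γ - 1)) =
      (2 * Real.sqrt (K * γ) / (γ - 1)) ^ (q / (γ - 1)) * v x t ^ (-(q / 2)) := by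
  have hγ' : 0 < γ - 1 := by linarith
  rw [etaF_eq hv hr, Real.mul_rpow (by positivity) (by positivity), ← Real.rpow_mul hv.le]
  congr 2
  field_simp

theorem Kcc_eq {K γ : ℝ} (hγ : 1 < γ) :
    Kcc K γ = Real.sqrt (K * γ) *
      ((2 * Real.sqrt (K * γ) / (γ - 1)) ^ ((γ + 1) / (γ - 1)))⁻¹ := by
  have hγ' : 0 < γ - 1 := by linarith
  have hk : 0 ≤ 2 * Real.sqrt (K * γ) / (γ - 1) := by positivity
  rw [Kcc, Ktau, ← Real.rpow_mul hk, ← Real.rpow_neg hk]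
  congr 2
  field_simp

theorem Cw_eq {K γ : ℝ} {d : ℕ} {v r : ℝ → ℝ → ℝ} {x t : ℝ} (hK : 0 < K) (hγ : 1 < γ)
    (hv : 0 < v x t) (hr : 0 < r x t) :
    Cw K γ d v r x t = soundSpeed K γ d v r x t / v x t := by
  have hγ' : 0 < γ - 1 := by linarith
  have hκ : 0 < Real.sqrt (K * γ) := Real.sqrt_pos.2 (by positivity)
  have hk : 0 < 2 * Real.sqrt (K * γ) / (γ - 1) := by positivity
  have hA : 0 < r x t ^ ((d : ℝ) - 1) := Real.rpow_pos_of_pos hr _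
  have hk' := (Real.rpow_pos_of_pos hk ((γ + 1) / (γ - 1))).ne'
  rw [Cw, Kcc_eq hγ, etaF_rpow hγ hv hr, soundSpeed, Afun, Real.mul_rpow hA.le hv.le,
    show -((γ + 1) / 2) = -(γ - 1) / 2 - 1 by ring, Real.rpow_sub_one hv.ne']
  field_simp

theorem LagSoln.eulerStrip {K γ T : ℝ} {d : ℕ} {v u r : ℝ → ℝ → ℝ} (hK : 0 < K) (hγ : 1 < γ)
    (hsol : LagSoln K γ d v u r (Ico 0 T)) :
    EulerStrip γ ((d : ℝ) - 1) T v u r (soundSpeed K γ d v r)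
      (fun x t => deriv (fun s => v s t) x) (fun x t => deriv (fun s => u s t) x) := by
  obtain ⟨hC, hP⟩ := hsol
  have vpos : ∀ x t, 0 < x → t ∈ Ico 0 T → 0 < v x t := fun x t hx ht => (hP x t hx ht).1
  have rpos : ∀ x t, 0 < x → t ∈ Ico 0 T → 0 < r x t := fun x t hx ht => (hP x t hx ht).2.1
  have hv : StripC1 T v (fun x t => deriv (fun s => v s t) x)
      (fun x t => deriv (fun s => u s t) x) :=
    (StripC1.of_contDiffOn (f := v) hC.fst).congr (fun _ _ _ _ => rfl)
      fun x t hx ht => (hP x t hx ht).2.2.1.symm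
  have hr : StripC1 T r v u :=
    (StripC1.of_contDiffOn (f := r) hC.snd.snd).congr
      (fun x t hx ht => (hP x t hx ht).2.2.2.2.1.symm)
      (fun x t hx ht => (hP x t hx ht).2.2.2.2.2.symm)
  refine ⟨hv, (StripC1.of_contDiffOn (f := u) hC.snd.fst).congr (fun _ _ _ _ => rfl)
    fun x t hx ht => ?_, hr, ⟨?_, ?_, fun x t hx ht => ?_, fun x t X X' hx ht hX hX' => ?_⟩,
    vpos, rpos⟩
  · have v0 := vpos x t hx ht
    have r0 := rpos x t hx ht
    have hA : 0 < r x t ^ ((d : ℝ) - 1) := Real.rpow_pos_of_pos r0 _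
    have hB := mul_pos hA v0
    have hp : (fun s => K * rhoF d v r s t ^ γ) =ᶠ[𝓝 x]
        fun s => K * (r s t ^ ((d : ℝ) - 1) * v s t) ^ (-γ) := by
      filter_upwards [Ioi_mem_nhds hx] with s hs
      have hB' : 0 ≤ r s t ^ ((d : ℝ) - 1) * v s t :=
        (mul_pos (Real.rpow_pos_of_pos (rpos s t hs ht) _) (vpos s t hs ht)).le
      rw [rhoF, Afun, Real.inv_rpow hB', Real.rpow_neg hB']
    have hpd := (hr.hasx x t hx ht).const_mul_rpow_mul_rpow (κ := K) (D := (d : ℝ) - 1) (q := -γ)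
      (hv.hasx x t hx ht) r0 v0
    have hmom := (hP x t hx ht).2.2.2.1
    rw [hp.deriv_eq, hpd.deriv, Afun] at hmom
    have hc2 : soundSpeed K γ d v r x t ^ 2 = K * γ * ((r x t ^ ((d : ℝ) - 1) * v x t) ^ (-γ) *
        (r x t ^ ((d : ℝ) - 1) * v x t)) := by
      rw [soundSpeed, mul_pow, Real.sq_sqrt (by positivity), ← Real.rpow_natCast, ← Real.rpow_mul
        hB.le, ← Real.rpow_add_one hB.ne']
      congr 2
      push_cast; ring
    rw [div_pow, hc2, eq_neg_of_add_eq_zero_left hmom]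
    field_simp
    ring
  · exact continuousOn_const.mul (((hr.cont.rpow_const fun p hp =>
      Or.inl (rpos _ _ hp.1 hp.2).ne').mul hv.cont).rpow_const fun p hp => Or.inl
        (mul_pos (Real.rpow_pos_of_pos (rpos _ _ hp.1 hp.2) _) (vpos _ _ hp.1 hp.2)).ne')
  · have hc : ContinuousOn (fun p : ℝ × ℝ => soundSpeed K γ d v r p.1 p.2) (strip T) :=
      continuousOn_const.mul (((hr.cont.rpow_const fun p hp =>
        Or.inl (rpos _ _ hp.1 hp.2).ne').mul hv.cont).rpow_const fun p hp => Or.inl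
          (mul_pos (Real.rpow_pos_of_pos (rpos _ _ hp.1 hp.2) _) (vpos _ _ hp.1 hp.2)).ne')
    exact hc.neg.mul (((continuousOn_const.mul hv.cont).div hr.cont fun p hp =>
      (rpos _ _ hp.1 hp.2).ne').add ((continuousOn_const.mul hv.contx).div hv.cont fun p hp =>
        (vpos _ _ hp.1 hp.2).ne'))
  · refine ((hr.hasx x t hx ht).const_mul_rpow_mul_rpow (hv.hasx x t hx ht) (rpos x t hx ht)
      (vpos x t hx ht)).congr_deriv ?_
    rw [soundSpeed]
    ring
  · have htI := Ioo_subset_Ico_self ht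
    refine ((hr.chain x t X X' hx ht hX hX').const_mul_rpow_mul_rpow
      (hv.chain x t X X' hx ht hX hX') (by rw [hX]; exact rpos x t hx htI)
      (by rw [hX]; exact vpos x t hx htI)).congr_deriv ?_
    rw [hX, soundSpeed]
    ring

/-- Bounded Riemann speed keeps `1/ρ` away from zero. -/
theorem le_of_mul_rpow_neg_le {κ M B q : ℝ} (hκ : 0 < κ) (hM : 0 < M) (hB : 0 < B) (hq : 0 < q)
    (h : κ * B ^ (-q) ≤ M) : (κ / M) ^ q⁻¹ ≤ B := by
  rw [Real.rpow_neg hB.le, ← div_eq_mul_inv, div_le_iff₀ (Real.rpow_pos_of_pos hB q),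
    ← div_le_iff₀' hM] at h
  calc (κ / M) ^ q⁻¹ ≤ (B ^ q) ^ q⁻¹ :=
        Real.rpow_le_rpow (by positivity) h (inv_nonneg.2 hq.le)
    _ = B := Real.rpow_rpow_inv hB.le hq.ne'

theorem threshold_lt {K γ N r₀ q D : ℝ} (hK : 0 < K) (hγ : 5 / 3 < γ)
    (hN : 4 * (γ - 1) / ((3 * γ - 5) * Kcc K γ) *
      ((γ - 1) * (3 * γ - 5) * D / 8 * r₀ ^ q) < N) :
    D * Real.sqrt (K * γ) * r₀ ^ q * (2 * Real.sqrt (K * γ) / (γ - 1)) ^ ((3 - γ) / (γ - 1)) * 2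
      < N := by
  have hγ' : 0 < γ - 1 := by linarith
  have hγ'' : 0 < 3 * γ - 5 := by linarith
  have hκ : 0 < Real.sqrt (K * γ) := Real.sqrt_pos.2 (by positivity)
  have hk : 0 < 2 * Real.sqrt (K * γ) / (γ - 1) := by positivity
  refine lt_of_eq_of_lt ?_ hN
  rw [Kcc_eq (by linarith), show (γ + 1) / (γ - 1) = (3 - γ) / (γ - 1) + (2 : ℕ) by
    push_cast; field_simp; ring, Real.rpow_add_natCast hk.ne']
  have hkθ := Real.rpow_pos_of_pos hk ((3 - γ) / (γ - 1))
  generalize (2 * Real.sqrt (K * γ) / (γ - 1)) ^ ((3 - γ) / (γ - 1)) = Q at hkθ ⊢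
  clear hN
  generalize 3 * γ - 5 = w at hγ'' ⊢
  field_simp
  ring

theorem alphaT_betaT_eq {K γ T : ℝ} {d : ℕ} {v u r : ℝ → ℝ → ℝ} (hγ : 1 < γ)
    (E : EulerStrip γ ((d : ℝ) - 1) T v u r (soundSpeed K γ d v r)
      (fun x t => deriv (fun s => v s t) x) (fun x t => deriv (fun s => u s t) x))
    {x t : ℝ} (hx : 0 < x) (ht : t ∈ Ico 0 T) :
    alphaT K γ d v u r x t = (2 * Real.sqrt (K * γ) / (γ - 1)) ^ ((3 - γ) / (γ - 1)) *
      (v x t ^ (-((3 - γ) / 2)) * (deriv (fun s => u s t) x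
        - soundSpeed K γ d v r x t / v x t * deriv (fun s => v s t) x)) ∧
    betaT K γ d v u r x t = (2 * Real.sqrt (K * γ) / (γ - 1)) ^ ((3 - γ) / (γ - 1)) *
      (v x t ^ (-((3 - γ) / 2)) * (deriv (fun s => u s t) x
        + soundSpeed K γ d v r x t / v x t * deriv (fun s => v s t) x)) := by
  have h1 := Afun_rpow_mul_deriv_etaF (K := K) (d := d) hγ hx
    (fun y hy => E.vpos y t hy ht) (fun y hy => E.rpos y t hy ht) (E.hv.hasx x t hx ht)
  have h2 := etaF_rpow (K := K) (d := d) hγ (E.vpos x t hx ht) (E.rpos x t hx ht) (3 - γ)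
  constructor
  · rw [alphaT, alphaF, h1, h2]; ring
  · rw [betaT, betaF, h1, h2]; ring

end

/-- **Uniform bound on the weighted gradient variables `α̃, β̃` for `5/3 < γ < 3`**
(Theorem 4.4 of the paper): in the domain of dependence `Ω` of `(x̄′,0)`, for a C¹
Lagrangian solution arising from initial data satisfying Assumption (A) — in particular
enjoying the supersonic bounds and with `r` minimized over `Ω` at `(x̄′,0)` — one has
`max(α̃,β̃) < N(x̄′)`, with `N(x̄′)` independent of `T`. -/
theorem weighted_gradient_bound_large_gamma
    (K γ C0 T xb N : ℝ) (d : ℕ) (v u r : ℝ → ℝ → ℝ)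
    (hK : 0 < K) (hγ1 : 5 / 3 < γ) (hγ2 : γ < 3) (hd : d = 2 ∨ d = 3)
    (hC0 : 0 < C0) (hT : 0 < T) (hxb : 0 < xb)
    (hsol : LagSoln K γ d v u r (Set.Ico 0 T))
    (hfrom : FromAssumptionA K γ C0 d v u r)
    (hss : Supersonic K γ C0 d v u r (Set.Ico 0 T))
    (hrmin : ∀ x t, InOmega K γ d v r xb x t → t < T → 0 < x ∧ r xb 0 ≤ r x t)
    (hN1 : ∀ x, xb ≤ x → alphaT K γ d v u r x 0 < N ∧ betaT K γ d v u r x 0 < N)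
    (hN2 : max (8 * (γ - 1) / ((3 - γ) * Kcc K γ)) (4 * (γ - 1) / ((3 * γ - 5) * Kcc K γ))
        * Khat γ d r xb < N) :
    ∀ x t, InOmega K γ d v r xb x t → 0 < t → t < T →
      alphaT K γ d v u r x t < N ∧ betaT K γ d v u r x t < N := by
  intro x₁ t₁ hΩ ht₁0 ht₁T
  have hγ : 1 < γ := by linarith
  have hγ' : 0 < γ - 1 := by linarith
  have hκ : 0 < Real.sqrt (K * γ) := Real.sqrt_pos.2 (by positivity)
  have hD : 0 < (d : ℝ) - 1 := by rcases hd with rfl | rfl <;> norm_num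
  have E := hsol.eulerStrip hK hγ
  obtain ⟨ht₁, xp, hxp0, hxp, hx₁⟩ := hΩ
  have hΩ : ∀ s ∈ Set.Icc 0 t₁, ∀ x, xp s ≤ x → 0 < x ∧ r xb 0 ≤ r x s := fun s hs x hx =>
    hrmin x s ⟨hs.1, xp, hxp0, fun τ hτ => hxp τ ⟨hτ.1, hτ.2.trans hs.2⟩, hx⟩
      (hs.2.trans_lt ht₁T)
  have hIco : ∀ s ∈ Set.Icc 0 t₁, s ∈ Set.Ico 0 T := fun s hs => ⟨hs.1, hs.2.trans_lt ht₁T⟩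
  have h0T : (0 : ℝ) ∈ Set.Ico 0 T := ⟨le_rfl, hT⟩
  have hpos : ∀ s ∈ Set.Icc 0 t₁, 0 < xp s := fun s hs => (hΩ s hs _ le_rfl).1
  have hr₀ : 0 < r xb 0 := E.rpos xb 0 hxb h0T
  set k := (2 * Real.sqrt (K * γ) / (γ - 1)) ^ ((3 - γ) / (γ - 1)) with hk
  have hkpos : 0 < k := Real.rpow_pos_of_pos (by positivity) _
  set q := ((d : ℝ) * (1 - γ) + γ - 3) / 2 with hq
  have hq0 : q ≤ 0 := by nlinarith
  have hn₀ : 0 ≤ ((d : ℝ) - 1) * Real.sqrt (K * γ) * r xb 0 ^ q := by positivity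
  have hn₀N : ((d : ℝ) - 1) * Real.sqrt (K * γ) * r xb 0 ^ q < N / k := by
    have hKhat : 0 ≤ Khat γ d r xb := by
      have : 0 < 3 * γ - 5 := by linarith
      rw [Khat]; positivity
    have h := threshold_lt hK hγ1
      ((mul_le_mul_of_nonneg_right (le_max_right _ _) hKhat).trans_lt hN2)
    rw [lt_div_iff₀ hkpos]
    nlinarith [mul_nonneg hn₀ hkpos.le]
  have hsound : ∀ x t, 0 < x → t ∈ Set.Ico 0 T →
      0 < soundSpeed K γ d v r x t ∧ 2 / (γ - 1) * soundSpeed K γ d v r x t ≤ u x t ∧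
      u x t ≤ 2 * C0 := by
    intro x t hx ht
    have h := hss x t hx ht
    rw [Afun_rpow_mul_etaF (E.vpos x t hx ht) (E.rpos x t hx ht)] at h
    exact ⟨pos_of_mul_pos_right h.1 (by positivity), h.2⟩
  have hres := E.weighted_gradient_lt
    (δ := (Real.sqrt (K * γ) / ((γ - 1) * C0)) ^ ((γ - 1) / 2)⁻¹) hγ1 hγ2 hD (by positivity)
    (fun x t hx ht => ?_) (fun x t hx ht => (hsound x t hx ht).1)
    (fun x t hx ht => (hsound x t hx ht).2.1) ht₁ ht₁T
    (fun s hs => Cw_eq hK hγ (E.vpos _ _ (hpos s hs) (hIco s hs))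
      (E.rpos _ _ (hpos s hs) (hIco s hs)) ▸ hxp s hs) hpos hn₀ hn₀N
    (fun s hs x hx => ?_) (fun x hx => ?_) hx₁
  · have hE := alphaT_betaT_eq hγ E ((hpos t₁ ⟨ht₁, le_rfl⟩).trans_le hx₁) ⟨ht₁, ht₁T⟩
    rw [hE.1, hE.2, ← hk, ← lt_div_iff₀' hkpos, ← lt_div_iff₀' hkpos]
    exact hres
  · refine le_of_mul_rpow_neg_le hκ (by positivity)
      (mul_pos (Real.rpow_pos_of_pos (E.rpos x t hx ht) _) (E.vpos x t hx ht)) (by positivity) ?_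
    have h := (hsound x t hx ht).2.1.trans (hsound x t hx ht).2.2
    rw [div_mul_eq_mul_div, div_le_iff₀ hγ', soundSpeed, neg_div] at h
    linarith
  · obtain ⟨hx0, hrx⟩ := hΩ s hs x hx
    have v0 := E.vpos x s hx0 (hIco s hs)
    have r0 := E.rpos x s hx0 (hIco s hs)
    have hA : 0 < r x s ^ ((d : ℝ) - 1) := Real.rpow_pos_of_pos r0 _
    have hrq : r x s ^ q ≤ r xb 0 ^ q := Real.rpow_le_rpow_of_nonpos hr₀ hrx hq0
    have hv : v x s ^ ((3 - γ) / 2) / v x s = v x s ^ (-(γ - 1) / 2) := by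
      rw [← Real.rpow_sub_one v0.ne']; congr 1; ring
    have hr : (r x s ^ ((d : ℝ) - 1)) ^ (-(γ - 1) / 2) / r x s = r x s ^ q := by
      rw [← Real.rpow_mul r0.le, ← Real.rpow_sub_one r0.ne', hq]; congr 1; ring
    calc ((d : ℝ) - 1) * soundSpeed K γ d v r x s / r x s
        = ((d : ℝ) - 1) * Real.sqrt (K * γ) * r x s ^ q * v x s ^ (-(γ - 1) / 2) := by
          rw [soundSpeed, Real.mul_rpow hA.le v0.le, ← hr]; ring
      _ ≤ ((d : ℝ) - 1) * Real.sqrt (K * γ) * r xb 0 ^ q * v x s ^ (-(γ - 1) / 2) := by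
          gcongr
      _ = _ := by rw [← hv]; ring
  · rw [hxp0] at hx
    have hE := alphaT_betaT_eq hγ E (hxb.trans_le hx) h0T
    have h := hN1 x hx
    rw [hE.1, hE.2, ← hk, ← lt_div_iff₀' hkpos, ← lt_div_iff₀' hkpos] at h
    exact h

end
end
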